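/- arXiv:1307.4973 — 3 statements merged into one kernel-verified Lean document; each statement's English description precedes it below -/
import Mathlib

section
/- Assume there exist ν > 0, γ ≥ 1, reals μ_i and diagonal positive definite matrices Q_i = diag[Q_i⁻, Q_i⁺] ∈ ℝ^{n×n} (Q_i⁻ ∈ ℝ^{m_i×m_i}, Q_i⁺ ∈ ℝ^{(n−m_i)×(n−m_i)}) such that, setting 𝒬_i(x) = diag[e^{2μ_i x} Q_i⁻, e^{−2μ_i x} Q_i⁺], for every i ∈ I and x ∈ [0,1]: −2μ_i𝒬_i(x)Λ_i⁺ + F_iᵀ𝒬_i(x) + 𝒬_i(x)F_i ≤ −2ν𝒬_i(x), and E₀ᵢᵀ 𝒬_i(0) Λ_i E₀ᵢ ≤ E₁ᵢᵀ 𝒬_i(1) Λ_i E₁ᵢ where E₀ᵢ = [[I_{m_i}, 0],[G_{i+−}, G_{i++}]] and E₁ᵢ = [[G_{i−−}, G_{i−+}],[0, I_{n−m_i}]], together with S_iᵀQ_iS_i ≤ γ S_jᵀQ_jS_j for all i,j ∈ I. Let Δ̄μ = 2|μ_i| if I is a singleton {i}, and Δ̄μ = 2 max_{i≠j∈I}(|μ_i|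 + |μ_j|) otherwise. Then for every N₀ ∈ ℕ and every τ_D > ln(γ)/(2ν) + Δ̄μ/ν, the switched linear hyperbolic system is globally uniformly exponentially stable with respect to 𝒮_{τ_D,N₀}: there exist ν' > 0 and C > 0 such that for every σ ∈ 𝒮_{τ_D,N₀} and every classical solution w, ‖w(t,·)‖_{L²((0,1);ℝⁿ)} ≤ C e^{−ν't} ‖w(0,·)‖_{L²((0,1);ℝⁿ)} for all t ≥ 0. -/
open Matrix Set Real

noncomputable section

/-- Loewner order on real matrices: `matLE A B` iff `B - A` is positive semidefinite. -/
def matLE {ι : Type*} [Fintype ι] (A B : Matrix ι ι ℝ) : Prop := (B - A).PosSemidef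

/-- If `f_t + g_x = h ≤ 0` on `[a,b] × [0,1]` and the flux `g` is larger at `x = 1` than at
`x = 0`, then `∫ f` does not increase from time `a` to time `b`. -/
theorem integral_le_of_divergence_nonpos {a b : ℝ} (hab : a ≤ b) (f g h : ℝ × ℝ → ℝ)
    (hd : ∀ p ∈ Icc a b ×ˢ Icc (0:ℝ) 1, ∃ f' g' : ℝ × ℝ →L[ℝ] ℝ,
      HasFDerivWithinAt f f' (Icc a b ×ˢ Icc (0:ℝ) 1) p ∧
      HasFDerivWithinAt g g' (Icc a b ×ˢ Icc (0:ℝ) 1) p ∧ f' (1, 0) + g' (0, 1) = h p)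
    (hc : ContinuousOn h (Icc a b ×ˢ Icc (0:ℝ) 1))
    (hh : ∀ p ∈ Icc a b ×ˢ Icc (0:ℝ) 1, h p ≤ 0)
    (hg : ∀ t ∈ Icc a b, g (t, 0) ≤ g (t, 1)) :
    ∫ x in (0:ℝ)..1, f (b, x) ≤ ∫ x in (0:ℝ)..1, f (a, x) := by
  choose! f' g' hf' hg' hsum using hd
  have hprod : Icc (a, (0:ℝ)) (b, 1) = Icc a b ×ˢ Icc (0:ℝ) 1 := (Icc_prod_eq _ _)
  have hint : ∀ p ∈ Ioo a b ×ˢ Ioo (0:ℝ) 1,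
      p ∈ Icc a b ×ˢ Icc (0:ℝ) 1 ∧ Icc a b ×ˢ Icc (0:ℝ) 1 ∈ nhds p := by
    intro p hp
    refine ⟨⟨Ioo_subset_Icc_self hp.1, Ioo_subset_Icc_self hp.2⟩, ?_⟩
    exact prod_mem_nhds (Icc_mem_nhds hp.1.1 hp.1.2) (Icc_mem_nhds hp.2.1 hp.2.2)
  have hcg : ContinuousOn g (Icc a b ×ˢ Icc (0:ℝ) 1) :=
    fun p hp => (hg' p hp).continuousWithinAt
  have hci : MeasureTheory.IntegrableOn h (Icc a b ×ˢ Icc (0:ℝ) 1) :=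
    hc.integrableOn_compact (isCompact_Icc.prod isCompact_Icc)
  have hmeas : MeasurableSet (Icc a b ×ˢ Icc (0:ℝ) 1) := measurableSet_Icc.prod measurableSet_Icc
  have key := MeasureTheory.integral_divergence_prod_Icc_of_hasFDerivAt_of_le f g f' g'
    (a, 0) (b, 1) ⟨hab, zero_le_one⟩
    (by rw [hprod]; exact fun p hp => (hf' p hp).continuousWithinAt)
    (by rw [hprod]; exact hcg)
    (fun p hp => (hf' p (hint p hp).1).hasFDerivAt (hint p hp).2)
    (fun p hp => (hg' p (hint p hp).1).hasFDerivAt (hint p hp).2)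
    (by rw [hprod]; exact hci.congr_fun (fun p hp => (hsum p hp).symm) hmeas)
  have hneg : ∫ p in Icc (a, (0:ℝ)) (b, 1), f' p (1, 0) + g' p (0, 1) ≤ 0 := by
    rw [hprod]
    exact MeasureTheory.setIntegral_nonpos hmeas fun p hp => (hsum p hp).trans_le (hh p hp)
  have hcont : ∀ y ∈ Icc (0:ℝ) 1,
      IntervalIntegrable (fun t => g (t, y)) MeasureTheory.volume a b := by
    intro y hy
    refine ContinuousOn.intervalIntegrable_of_Icc hab ?_
    exact hcg.comp (by fun_prop) fun t ht => ⟨ht, hy⟩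
  have hmono : ∫ t in a..b, g (t, 0) ≤ ∫ t in a..b, g (t, 1) :=
    intervalIntegral.integral_mono_on hab (hcont 0 (by simp)) (hcont 1 (by simp)) hg
  simp only at key
  linarith

theorem hasFDerivWithinAt_exp_mul_weight_mul_sq {R : Set (ℝ × ℝ)} {p : ℝ × ℝ} (c : ℝ)
    {Q : ℝ → ℝ} {Q' : ℝ} {u : ℝ × ℝ → ℝ} {u' : ℝ × ℝ →L[ℝ] ℝ}
    (hQ : HasDerivAt Q Q' p.2) (hu : HasFDerivWithinAt u u' R p) :
    ∃ D : ℝ × ℝ →L[ℝ] ℝ,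
      HasFDerivWithinAt (fun p : ℝ × ℝ => Real.exp (c * p.1) * (Q p.2 * (u p) ^ 2)) D R p ∧
      ∀ v, D v = Real.exp (c * p.1) *
        (c * v.1 * Q p.2 * u p ^ 2 + Q' * v.2 * u p ^ 2 + 2 * Q p.2 * u p * u' v) := by
  have h1 : HasFDerivWithinAt (fun p : ℝ × ℝ => Real.exp (c * p.1)) _ R p :=
    ((hasFDerivWithinAt_fst (𝕜 := ℝ) (p := p) (s := R)).const_mul c).exp
  have h2 := hQ.comp_hasFDerivWithinAt p (hasFDerivWithinAt_snd (𝕜 := ℝ) (p := p) (s := R))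
  refine ⟨_, h1.mul (h2.mul (hu.pow 2)), fun v => ?_⟩
  simp
  ring

/-- Decay of the weighted energy of a diagonal hyperbolic system on a time interval. -/
theorem diagonal_system_energy_decay {n : ℕ} {a b : ℝ} (hab : a ≤ b) (c : ℝ)
    (u : ℝ × ℝ → Fin n → ℝ) (u' : ℝ × ℝ → (ℝ × ℝ →L[ℝ] (Fin n → ℝ)))
    (lam : Fin n → ℝ) (F : Matrix (Fin n) (Fin n) ℝ) (Q Q' : Fin n → ℝ → ℝ)
    (hQ : ∀ k x, HasDerivAt (Q k) (Q' k x) x) (hQ' : ∀ k, Continuous (Q' k))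
    (hu : ∀ p ∈ Icc a b ×ˢ Icc (0:ℝ) 1,
      HasFDerivWithinAt u (u' p) (Icc a b ×ˢ Icc (0:ℝ) 1) p)
    (hpde : ∀ p ∈ Icc a b ×ˢ Icc (0:ℝ) 1, ∀ k,
      u' p (1, 0) k + lam k * u' p (0, 1) k = (F *ᵥ u p) k)
    (hlmi : ∀ x ∈ Icc (0:ℝ) 1, ∀ z : Fin n → ℝ,
      ∑ k, (c * Q k x * z k ^ 2 + lam k * Q' k x * z k ^ 2 + 2 * Q k x * z k * (F *ᵥ z) k) ≤ 0)
    (hbc : ∀ t ∈ Icc a b, ∑ k, lam k * Q k 0 * u (t, 0) k ^ 2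
      ≤ ∑ k, lam k * Q k 1 * u (t, 1) k ^ 2) :
    ∫ x in (0:ℝ)..1, ∑ k, Q k x * u (b, x) k ^ 2
      ≤ Real.exp (-(c * (b - a))) * ∫ x in (0:ℝ)..1, ∑ k, Q k x * u (a, x) k ^ 2 := by
  have hQc : ∀ k, Continuous (Q k) := fun k =>
    continuous_iff_continuousAt.2 fun x => (hQ k x).continuousAt
  have huc : ContinuousOn u (Icc a b ×ˢ Icc (0:ℝ) 1) := fun p hp => (hu p hp).continuousWithinAt
  have key := integral_le_of_divergence_nonpos hab
    (fun p => ∑ k, Real.exp (c * p.1) * (Q k p.2 * u p k ^ 2))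
    (fun p => ∑ k, Real.exp (c * p.1) * ((lam k * Q k p.2) * u p k ^ 2))
    (fun p => Real.exp (c * p.1) * ∑ k, (c * Q k p.2 * u p k ^ 2 + lam k * Q' k p.2 * u p k ^ 2
      + 2 * Q k p.2 * u p k * (F *ᵥ u p) k)) ?_ ?_ ?_ ?_
  · simp only [← Finset.mul_sum, intervalIntegral.integral_const_mul] at key
    have e1 : Real.exp (-(c * (b - a))) = Real.exp (c * a) / Real.exp (c * b) := by
      rw [← Real.exp_sub]; ring_nf
    rw [e1, div_mul_eq_mul_div, le_div_iff₀ (Real.exp_pos _), mul_comm]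
    exact key
  · intro p hp
    have huk := fun k => hasFDerivWithinAt_pi'.1 (hu p hp) k
    choose D hD hDv using fun k =>
      hasFDerivWithinAt_exp_mul_weight_mul_sq c (hQ k p.2) (huk k)
    choose E hE hEv using fun k =>
      hasFDerivWithinAt_exp_mul_weight_mul_sq c ((hQ k p.2).const_mul (lam k)) (huk k)
    refine ⟨_, _, HasFDerivWithinAt.fun_sum fun k _ => hD k,
      HasFDerivWithinAt.fun_sum fun k _ => hE k, ?_⟩
    simp only [_root_.sum_apply, hDv, hEv, ← Finset.sum_add_distrib, Finset.mul_sum]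
    refine Finset.sum_congr rfl fun k _ => ?_
    rw [← hpde p hp k]
    simp
    ring
  · have : ∀ k, ContinuousOn (fun p => (F *ᵥ u p) k) (Icc a b ×ˢ Icc (0:ℝ) 1) := by
      intro k
      simp only [Matrix.mulVec, dotProduct]
      fun_prop
    fun_prop
  · intro p hp
    exact mul_nonpos_of_nonneg_of_nonpos (Real.exp_pos _).le (hlmi p.2 hp.2 (u p))
  · intro t ht
    simp only [← Finset.mul_sum]
    exact mul_le_mul_of_nonneg_left (hbc t ht) (Real.exp_pos _).le

theorem exists_pos_forall_sum_mulVec_sq_le {n : ℕ} {I : Type*} [Fintype I]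
    (M : I → Matrix (Fin n) (Fin n) ℝ) :
    ∃ K > (0:ℝ), ∀ i z, ∑ k, (M i *ᵥ z) k ^ 2 ≤ K * ∑ k, z k ^ 2 := by
  refine ⟨1 + ∑ i, ∑ k, ∑ l, M i k l ^ 2, by positivity, fun i z => ?_⟩
  have h1 : ∑ k, (M i *ᵥ z) k ^ 2 ≤ (∑ k, ∑ l, M i k l ^ 2) * ∑ k, z k ^ 2 := by
    rw [Finset.sum_mul]
    exact Finset.sum_le_sum fun k _ => Finset.sum_mul_sq_le_sq_mul_sq Finset.univ (M i k) z
  have h2 : ∑ k, ∑ l, M i k l ^ 2 ≤ ∑ i, ∑ k, ∑ l, M i k l ^ 2 :=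
    Finset.single_le_sum (f := fun i => ∑ k, ∑ l, M i k l ^ 2)
      (fun _ _ => by positivity) (Finset.mem_univ i)
  exact h1.trans (mul_le_mul_of_nonneg_right (by linarith) (by positivity))

theorem matLE.dotProduct_mulVec_le {n : ℕ} {X Y : Matrix (Fin n) (Fin n) ℝ} (h : matLE X Y)
    (z : Fin n → ℝ) : z ⬝ᵥ (X *ᵥ z) ≤ z ⬝ᵥ (Y *ᵥ z) := by
  have := h.dotProduct_mulVec_nonneg z
  simpa [Matrix.sub_mulVec, dotProduct_sub] using this

theorem dotProduct_transpose_mul_diagonal_mul_mulVec {n : ℕ} (E : Matrix (Fin n) (Fin n) ℝ)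
    (d z : Fin n → ℝ) :
    z ⬝ᵥ ((Eᵀ * Matrix.diagonal d * E) *ᵥ z) = ∑ k, d k * (E *ᵥ z) k ^ 2 := by
  rw [← Matrix.mulVec_mulVec, ← Matrix.mulVec_mulVec, Matrix.dotProduct_mulVec,
    Matrix.vecMul_transpose]
  simp only [dotProduct, Matrix.mulVec_diagonal]
  exact Finset.sum_congr rfl fun k _ => by ring

/-- Iteration of exponential decay between switching times with a bounded jump at each of
them. -/
theorem le_of_decay_between_of_jump {V : ℝ → ℝ} {times : Set ℝ} {c κ : ℝ}
    (hfin : ∀ T : ℝ, (times ∩ Icc 0 T).Finite)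
    (hdecay : ∀ s t, 0 ≤ s → s ≤ t → (∀ u, s < u → u ≤ t → u ∉ times) →
      V t ≤ Real.exp (-(c * (t - s))) * V s)
    (hjump : ∀ s t, 0 ≤ s → s < t → (∀ u, s < u → u < t → u ∉ times) →
      V t ≤ Real.exp κ * Real.exp (-(c * (t - s))) * V s)
    (N : ℕ) (s t : ℝ) (hs : 0 ≤ s) (hst : s ≤ t) (hN : (times ∩ Ioc s t).ncard = N) :
    V t ≤ Real.exp (κ * N) * Real.exp (-(c * (t - s))) * V s := by
  induction N generalizing s with
  | zero =>
    have hf : (times ∩ Ioc s t).Finite :=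
      (hfin t).subset fun u hu => ⟨hu.1, hs.trans hu.2.1.le, hu.2.2⟩
    rw [Set.ncard_eq_zero hf] at hN
    have := hdecay s t hs hst fun u h1 h2 h3 => by
      have : u ∈ times ∩ Ioc s t := ⟨h3, h1, h2⟩
      simp [hN] at this
    simpa using this
  | succ N ih =>
    have hf : (times ∩ Ioc s t).Finite :=
      (hfin t).subset fun u hu => ⟨hu.1, hs.trans hu.2.1.le, hu.2.2⟩
    have hne : (times ∩ Ioc s t).Nonempty := by
      rw [← Set.ncard_pos hf]; omega
    obtain ⟨r, ⟨hr, hsr, hrt⟩, hmin⟩ := hf.exists_minimal hne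
    have hfree : ∀ u, s < u → u < r → u ∉ times := fun u h1 h2 h3 =>
      (hmin ⟨h3, h1, h2.le.trans hrt⟩ h2.le).not_gt h2
    have hset : times ∩ Ioc s t = insert r (times ∩ Ioc r t) := by
      ext u
      simp only [mem_inter_iff, mem_Ioc, mem_insert_iff]
      constructor
      · rintro ⟨h1, h2, h3⟩
        rcases lt_trichotomy u r with h | h | h
        · exact (hfree u h2 h h1).elim
        · exact Or.inl h
        · exact Or.inr ⟨h1, h, h3⟩
      · rintro (rfl | ⟨h1, h2, h3⟩)
        · exact ⟨hr, hsr, hrt⟩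
        · exact ⟨h1, hsr.trans h2, h3⟩
    have hcard : (times ∩ Ioc r t).ncard = N := by
      rw [hset, Set.ncard_insert_of_notMem (by simp)
        ((hfin t).subset fun u hu => ⟨hu.1, (hs.trans hsr.le).trans hu.2.1.le, hu.2.2⟩)] at hN
      omega
    have h1 := ih r (hs.trans hsr.le) hrt hcard
    have h2 := hjump s r hs hsr hfree
    calc V t ≤ Real.exp (κ * N) * Real.exp (-(c * (t - r))) * V r := h1
      _ ≤ Real.exp (κ * N) * Real.exp (-(c * (t - r))) *
          (Real.exp κ * Real.exp (-(c * (r - s))) * V s) := by gcongr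
      _ = Real.exp (κ * (N + 1 : ℕ)) * Real.exp (-(c * (t - s))) * V s := by
        have : Real.exp (κ * (N + 1 : ℕ)) * Real.exp (-(c * (t - s))) =
            Real.exp (κ * N) * Real.exp (-(c * (t - r))) *
              (Real.exp κ * Real.exp (-(c * (r - s)))) := by
          simp only [← Real.exp_add]
          congr 1
          push_cast
          ring
        rw [this]
        ring

/-- Entries of the diagonal Lyapunov weight `diag[e^{2μx} Q⁻, e^{-2μx} Q⁺]`. -/
def energyWeight {n : ℕ} (m : ℕ) (μ : ℝ) (q : Fin n → ℝ) (k : Fin n) (x : ℝ) : ℝ :=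
  if (k : ℕ) < m then Real.exp (2 * μ * x) * q k else Real.exp (-(2 * μ * x)) * q k

theorem hasDerivAt_energyWeight {n : ℕ} (m : ℕ) (μ : ℝ) (q : Fin n → ℝ) (k : Fin n) (x : ℝ) :
    HasDerivAt (energyWeight m μ q k)
      ((if (k : ℕ) < m then 2 * μ else -(2 * μ)) * energyWeight m μ q k x) x := by
  unfold energyWeight
  have h := (hasDerivAt_id x).const_mul (2 * μ)
  split_ifs
  · exact (h.exp.mul_const (q k)).congr_deriv (by simp; ring)
  · exact (h.fun_neg.exp.mul_const (q k)).congr_deriv (by simp; ring)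

theorem continuous_energyWeight {n : ℕ} (m : ℕ) (μ : ℝ) (q : Fin n → ℝ) (k : Fin n) :
    Continuous (energyWeight m μ q k) :=
  continuous_iff_continuousAt.2 fun x => (hasDerivAt_energyWeight m μ q k x).continuousAt

theorem abs_two_mul_mul_le {μ x : ℝ} (hx : x ∈ Icc (0:ℝ) 1) : |2 * μ * x| ≤ 2 * |μ| := by
  rw [abs_mul, abs_mul, abs_two, abs_of_nonneg hx.1]
  exact mul_le_of_le_one_right (by positivity) hx.2

theorem energyWeight_le {n : ℕ} (m : ℕ) (μ : ℝ) {q : Fin n → ℝ} {k : Fin n} (hq : 0 < q k)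
    {x : ℝ} (hx : x ∈ Icc (0:ℝ) 1) :
    energyWeight m μ q k x ≤ Real.exp (2 * |μ|) * q k := by
  have h := abs_le.1 (abs_two_mul_mul_le (μ := μ) hx)
  unfold energyWeight
  split_ifs <;> exact mul_le_mul_of_nonneg_right (Real.exp_le_exp.2 (by linarith)) hq.le

theorem le_exp_mul_energyWeight {n : ℕ} (m : ℕ) (μ : ℝ) {q : Fin n → ℝ} {k : Fin n}
    (hq : 0 < q k) {x : ℝ} (hx : x ∈ Icc (0:ℝ) 1) :
    q k ≤ Real.exp (2 * |μ|) * energyWeight m μ q k x := by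
  have h := abs_le.1 (abs_two_mul_mul_le (μ := μ) hx)
  unfold energyWeight
  split_ifs <;> rw [← mul_assoc, ← Real.exp_add] <;>
    exact le_mul_of_one_le_left hq.le (Real.one_le_exp (by linarith))

theorem dotProduct_lyapunov_mulVec_le {n m : ℕ} {lam d : Fin n → ℝ}
    {F : Matrix (Fin n) (Fin n) ℝ} {μ ν : ℝ}
    (hlam : ∀ k : Fin n, if (k : ℕ) < m then lam k < 0 else 0 < lam k)
    (h : matLE (-(2 * μ) • (Matrix.diagonal d * Matrix.diagonal (fun k => |lam k|))
        + Fᵀ * Matrix.diagonal d + Matrix.diagonal d * F) (-(2 * ν) • Matrix.diagonal d))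
    (z : Fin n → ℝ) :
    ∑ k, (2 * ν * d k * z k ^ 2
      + lam k * ((if (k : ℕ) < m then 2 * μ else -(2 * μ)) * d k) * z k ^ 2
      + 2 * d k * z k * (F *ᵥ z) k) ≤ 0 := by
  have key := h.dotProduct_mulVec_le z
  have hF : z ⬝ᵥ ((Fᵀ * Matrix.diagonal d) *ᵥ z) = ∑ k, d k * z k * (F *ᵥ z) k := by
    rw [← Matrix.mulVec_mulVec, Matrix.dotProduct_mulVec, Matrix.vecMul_transpose]
    simp only [dotProduct, Matrix.mulVec_diagonal]
    exact Finset.sum_congr rfl fun k _ => by ring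
  have hF' : z ⬝ᵥ ((Matrix.diagonal d * F) *ᵥ z) = ∑ k, d k * z k * (F *ᵥ z) k := by
    rw [← Matrix.mulVec_mulVec]
    simp only [dotProduct, Matrix.mulVec_diagonal]
    exact Finset.sum_congr rfl fun k _ => by ring
  rw [Matrix.add_mulVec, Matrix.add_mulVec, dotProduct_add, dotProduct_add, hF, hF',
    Matrix.diagonal_mul_diagonal, Matrix.smul_mulVec, Matrix.smul_mulVec, dotProduct_smul,
    dotProduct_smul] at key
  simp only [dotProduct, Matrix.mulVec_diagonal, smul_eq_mul, Finset.mul_sum,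
    ← Finset.sum_add_distrib] at key
  rw [← sub_nonpos, ← Finset.sum_sub_distrib] at key
  refine le_of_eq_of_le (Finset.sum_congr rfl fun k _ => ?_) key
  have hk := hlam k
  split_ifs at hk ⊢
  · rw [abs_of_neg hk]; ring
  · rw [abs_of_pos hk]; ring

/-- The boundary conditions express both traces through the incoming vector
`(v⁻(0), v⁺(1))`. -/
theorem boundary_traces_eq {n m : ℕ} {G : Matrix (Fin n) (Fin n) ℝ} {u0 u1 : Fin n → ℝ}
    (h : (Matrix.of fun k l : Fin n =>
        if (l : ℕ) < m then -(G k l) else if k = l then (1:ℝ) else 0) *ᵥ u0 +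
      (Matrix.of fun k l : Fin n =>
        if (l : ℕ) < m then (if k = l then (1:ℝ) else 0) else -(G k l)) *ᵥ u1 = 0) :
    ∃ z : Fin n → ℝ,
      (Matrix.of fun k l : Fin n =>
        if (k : ℕ) < m then (if k = l then (1:ℝ) else 0) else G k l) *ᵥ z = u0 ∧
      (Matrix.of fun k l : Fin n =>
        if (k : ℕ) < m then G k l else if k = l then (1:ℝ) else 0) *ᵥ z = u1 := by
  set z : Fin n → ℝ := fun l => if (l : ℕ) < m then u0 l else u1 l with hz
  have hG : ∀ k, ∑ l, G k l * z l = if (k : ℕ) < m then u1 k else u0 k := by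
    intro k
    have hk := congrFun h k
    simp only [Pi.add_apply, Pi.zero_apply, Matrix.mulVec, dotProduct, Matrix.of_apply,
      ← Finset.sum_add_distrib] at hk
    have hterm : ∀ l : Fin n,
        (if (l : ℕ) < m then -(G k l) else if k = l then (1:ℝ) else 0) * u0 l +
          (if (l : ℕ) < m then (if k = l then (1:ℝ) else 0) else -(G k l)) * u1 l
        = (if k = l then (if (l : ℕ) < m then u1 l else u0 l) else 0) - G k l * z l := by
      intro l
      simp only [hz]
      split_ifs <;> ring
    simp only [hterm, Finset.sum_sub_distrib, Finset.sum_ite_eq, Finset.mem_univ, if_true] at hk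
    linarith
  refine ⟨z, ?_, ?_⟩
  · ext k
    have := hG k
    simp only [Matrix.mulVec, dotProduct, Matrix.of_apply]
    split_ifs at this ⊢ with hk
    · simp [show z k = u0 k from if_pos hk]
    · exact this
  · ext k
    have := hG k
    simp only [Matrix.mulVec, dotProduct, Matrix.of_apply]
    split_ifs at this ⊢ with hk
    · exact this
    · simp [show z k = u1 k from if_neg hk]

/-- Exponential decay of the Lyapunov functional of a single mode between two times. -/
theorem mode_energy_decay {n m : ℕ} {S A L F G B0 B1 E0 E1 : Matrix (Fin n) (Fin n) ℝ}
    (hS : IsUnit S) {lam q : Fin n → ℝ} {μ ν : ℝ}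
    (hlam : ∀ k : Fin n, if (k : ℕ) < m then lam k < 0 else 0 < lam k)
    (hL : L = S⁻¹ * Matrix.diagonal lam * S) (hF : F = S * A * S⁻¹)
    (hB0 : B0 = (Matrix.of fun k l : Fin n =>
        if (l : ℕ) < m then -(G k l) else if k = l then (1:ℝ) else 0) * S)
    (hB1 : B1 = (Matrix.of fun k l : Fin n =>
        if (l : ℕ) < m then (if k = l then (1:ℝ) else 0) else -(G k l)) * S)
    (hE0 : E0 = Matrix.of fun k l : Fin n =>
        if (k : ℕ) < m then (if k = l then (1:ℝ) else 0) else G k l)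
    (hE1 : E1 = Matrix.of fun k l : Fin n =>
        if (k : ℕ) < m then G k l else if k = l then (1:ℝ) else 0)
    (hlmi1 : ∀ x ∈ Icc (0:ℝ) 1,
      matLE (-(2 * μ) • (Matrix.diagonal (fun k => energyWeight m μ q k x) *
          Matrix.diagonal (fun k => |lam k|))
        + Fᵀ * Matrix.diagonal (fun k => energyWeight m μ q k x)
        + Matrix.diagonal (fun k => energyWeight m μ q k x) * F)
        (-(2 * ν) • Matrix.diagonal (fun k => energyWeight m μ q k x)))
    (hlmi2 : matLE
      (E0ᵀ * (Matrix.diagonal (fun k => energyWeight m μ q k 0) * Matrix.diagonal lam) * E0)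
      (E1ᵀ * (Matrix.diagonal (fun k => energyWeight m μ q k 1) * Matrix.diagonal lam) * E1))
    {w : ℝ → ℝ → Fin n → ℝ} {a b : ℝ} (hab : a ≤ b)
    (hw : ContDiffOn ℝ 1 (fun pt : ℝ × ℝ => w pt.1 pt.2) (Icc a b ×ˢ Icc (0:ℝ) 1))
    (hpde : ∀ t ∈ Icc a b, ∀ x ∈ Icc (0:ℝ) 1,
      fderivWithin ℝ (fun pt : ℝ × ℝ => w pt.1 pt.2) (Icc a b ×ˢ Icc (0:ℝ) 1) (t, x) (1, 0)
        + L *ᵥ (fderivWithin ℝ (fun pt : ℝ × ℝ => w pt.1 pt.2)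
            (Icc a b ×ˢ Icc (0:ℝ) 1) (t, x) (0, 1)) = A *ᵥ (w t x))
    (hbc : ∀ t ∈ Icc a b, B0 *ᵥ (w t 0) + B1 *ᵥ (w t 1) = 0) :
    ∫ x in (0:ℝ)..1, ∑ k, energyWeight m μ q k x * (S *ᵥ w b x) k ^ 2 ≤
      Real.exp (-(2 * ν * (b - a))) *
        ∫ x in (0:ℝ)..1, ∑ k, energyWeight m μ q k x * (S *ᵥ w a x) k ^ 2 := by
  have hdet : IsUnit S.det := (Matrix.isUnit_iff_isUnit_det S).1 hS
  refine diagonal_system_energy_decay hab (2 * ν) (fun p => S *ᵥ w p.1 p.2)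
    (fun p => (LinearMap.toContinuousLinearMap (Matrix.mulVecLin S)).comp
      (fderivWithin ℝ (fun pt : ℝ × ℝ => w pt.1 pt.2) (Icc a b ×ˢ Icc (0:ℝ) 1) p))
    lam F (energyWeight m μ q) _ (hasDerivAt_energyWeight m μ q) ?_ ?_ ?_ ?_ ?_
  · exact fun k => continuous_const.mul (continuous_energyWeight m μ q k)
  · intro p hp
    exact (LinearMap.toContinuousLinearMap (Matrix.mulVecLin S)).hasFDerivAt.comp_hasFDerivWithinAt
      p ((hw.differentiableOn one_ne_zero) p hp).hasFDerivWithinAt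
  · intro p hp k
    have h := congrArg (fun v => (S *ᵥ v) k) (hpde p.1 hp.1 p.2 hp.2)
    simp only [Matrix.mulVec_add, Matrix.mulVec_mulVec, Pi.add_apply] at h
    have e1 : S * L = Matrix.diagonal lam * S := by
      rw [hL, ← mul_assoc, ← mul_assoc, Matrix.mul_nonsing_inv S hdet, one_mul]
    have e2 : F * S = S * A := by
      rw [hF, mul_assoc, Matrix.nonsing_inv_mul S hdet, mul_one]
    rw [e1, ← e2, ← Matrix.mulVec_mulVec, ← Matrix.mulVec_mulVec, Matrix.mulVec_diagonal] at h
    exact h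
  · intro x hx z
    exact dotProduct_lyapunov_mulVec_le hlam (hlmi1 x hx) z
  · intro t ht
    have hb := hbc t ht
    rw [hB0, hB1, ← Matrix.mulVec_mulVec, ← Matrix.mulVec_mulVec] at hb
    obtain ⟨z, h0, h1⟩ := boundary_traces_eq hb
    rw [← hE0] at h0
    rw [← hE1] at h1
    have h2 := hlmi2.dotProduct_mulVec_le z
    simp only [Matrix.diagonal_mul_diagonal, dotProduct_transpose_mul_diagonal_mul_mulVec,
      h0, h1] at h2
    simpa only [mul_comm] using h2

theorem sum_energyWeight_mul_sq_le {n : ℕ} (m : ℕ) (μ : ℝ) {q : Fin n → ℝ} (hq : ∀ k, 0 < q k)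
    {x : ℝ} (hx : x ∈ Icc (0:ℝ) 1) (y : Fin n → ℝ) :
    ∑ k, energyWeight m μ q k x * y k ^ 2 ≤ Real.exp (2 * |μ|) * ∑ k, q k * y k ^ 2 := by
  rw [Finset.mul_sum]
  refine Finset.sum_le_sum fun k _ => ?_
  rw [← mul_assoc]
  exact mul_le_mul_of_nonneg_right (energyWeight_le m μ (hq k) hx) (sq_nonneg _)

theorem sum_mul_sq_le_sum_energyWeight {n : ℕ} (m : ℕ) (μ : ℝ) {q : Fin n → ℝ}
    (hq : ∀ k, 0 < q k) {x : ℝ} (hx : x ∈ Icc (0:ℝ) 1) (y : Fin n → ℝ) :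
    ∑ k, q k * y k ^ 2 ≤ Real.exp (2 * |μ|) * ∑ k, energyWeight m μ q k x * y k ^ 2 := by
  rw [Finset.mul_sum]
  refine Finset.sum_le_sum fun k _ => ?_
  rw [← mul_assoc]
  exact mul_le_mul_of_nonneg_right (le_exp_mul_energyWeight m μ (hq k) hx) (sq_nonneg _)

theorem exists_pos_forall_le {α : Type*} [Finite α] (f : α → ℝ) : ∃ R > (0:ℝ), ∀ a, f a ≤ R := by
  obtain ⟨R, hR⟩ := (Set.finite_range f).bddAbove
  exact ⟨max R 1, by positivity, fun a => (hR (mem_range_self a)).trans (le_max_left _ _)⟩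

theorem sum_energyWeight_le_jump {n m₁ m₂ : ℕ} {S₁ S₂ : Matrix (Fin n) (Fin n) ℝ}
    {q₁ q₂ : Fin n → ℝ} (hq₁ : ∀ k, 0 < q₁ k) (hq₂ : ∀ k, 0 < q₂ k) {μ₁ μ₂ γ : ℝ} (hγ : 0 < γ)
    (h : matLE (S₁ᵀ * Matrix.diagonal q₁ * S₁) (γ • (S₂ᵀ * Matrix.diagonal q₂ * S₂)))
    {x : ℝ} (hx : x ∈ Icc (0:ℝ) 1) (z : Fin n → ℝ) :
    ∑ k, energyWeight m₁ μ₁ q₁ k x * (S₁ *ᵥ z) k ^ 2 ≤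
      Real.exp (Real.log γ + 2 * (|μ₁| + |μ₂|)) *
        ∑ k, energyWeight m₂ μ₂ q₂ k x * (S₂ *ᵥ z) k ^ 2 := by
  have h1 := h.dotProduct_mulVec_le z
  rw [Matrix.smul_mulVec, dotProduct_smul, smul_eq_mul,
    dotProduct_transpose_mul_diagonal_mul_mulVec,
    dotProduct_transpose_mul_diagonal_mul_mulVec] at h1
  calc _ ≤ Real.exp (2 * |μ₁|) * ∑ k, q₁ k * (S₁ *ᵥ z) k ^ 2 :=
        sum_energyWeight_mul_sq_le m₁ μ₁ hq₁ hx _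
    _ ≤ Real.exp (2 * |μ₁|) * (γ * ∑ k, q₂ k * (S₂ *ᵥ z) k ^ 2) := by gcongr
    _ ≤ Real.exp (2 * |μ₁|) * (γ * (Real.exp (2 * |μ₂|) *
          ∑ k, energyWeight m₂ μ₂ q₂ k x * (S₂ *ᵥ z) k ^ 2)) := by
        gcongr
        exact sum_mul_sq_le_sum_energyWeight m₂ μ₂ hq₂ hx _
    _ = _ := by
        rw [mul_add, Real.exp_add, Real.exp_add, Real.exp_log hγ]
        ring

/-- The mode-wise Lyapunov densities are uniformly equivalent to the squared Euclidean norm. -/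
theorem exists_energy_equivalence {n : ℕ} {I : Type*} [Fintype I] (m : I → ℕ)
    (S : I → Matrix (Fin n) (Fin n) ℝ) (hS : ∀ i, IsUnit (S i)) (μ : I → ℝ)
    (q : I → Fin n → ℝ) (hq : ∀ i k, 0 < q i k) :
    ∃ K₁ > (0:ℝ), ∃ K₂ > (0:ℝ), ∀ i, ∀ x ∈ Icc (0:ℝ) 1, ∀ z : Fin n → ℝ,
      ∑ k, z k ^ 2 ≤ K₁ * ∑ k, energyWeight (m i) (μ i) (q i) k x * (S i *ᵥ z) k ^ 2 ∧
      ∑ k, energyWeight (m i) (μ i) (q i) k x * (S i *ᵥ z) k ^ 2 ≤ K₂ * ∑ k, z k ^ 2 := by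
  obtain ⟨M, hM, hMb⟩ := exists_pos_forall_le fun i => Real.exp (2 * |μ i|)
  obtain ⟨a, ha, hab⟩ := exists_pos_forall_le fun ik : I × Fin n => (q ik.1 ik.2)⁻¹
  obtain ⟨b, hb, hbb⟩ := exists_pos_forall_le fun ik : I × Fin n => q ik.1 ik.2
  obtain ⟨c, hc, hcb⟩ := exists_pos_forall_sum_mulVec_sq_le fun i => (S i)⁻¹
  obtain ⟨d, hd, hdb⟩ := exists_pos_forall_sum_mulVec_sq_le S
  refine ⟨c * (a * M), by positivity, M * (b * d), by positivity, fun i x hx z => ⟨?_, ?_⟩⟩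
  · have hdet : IsUnit (S i).det := (Matrix.isUnit_iff_isUnit_det _).1 (hS i)
    have h1 := hcb i (S i *ᵥ z)
    rw [Matrix.mulVec_mulVec, Matrix.nonsing_inv_mul _ hdet, Matrix.one_mulVec] at h1
    have h2 : ∑ k, (S i *ᵥ z) k ^ 2 ≤ a * ∑ k, q i k * (S i *ᵥ z) k ^ 2 := by
      rw [Finset.mul_sum]
      refine Finset.sum_le_sum fun k _ => ?_
      rw [← mul_assoc]
      refine le_mul_of_one_le_left (sq_nonneg _) ?_
      calc (1:ℝ) = (q i k)⁻¹ * q i k := (inv_mul_cancel₀ (hq i k).ne').symm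
        _ ≤ a * q i k := mul_le_mul_of_nonneg_right (hab (i, k)) (hq i k).le
    have h3 := sum_mul_sq_le_sum_energyWeight (m i) (μ i) (hq i) hx (S i *ᵥ z)
    have hnn : 0 ≤ ∑ k, energyWeight (m i) (μ i) (q i) k x * (S i *ᵥ z) k ^ 2 := by
      have : 0 ≤ ∑ k, q i k * (S i *ᵥ z) k ^ 2 :=
        Finset.sum_nonneg fun k _ => mul_nonneg (hq i k).le (sq_nonneg _)
      exact nonneg_of_mul_nonneg_right (this.trans h3) (Real.exp_pos _)
    calc _ ≤ _ := h1
      _ ≤ c * (a * (Real.exp (2 * |μ i|) *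
          ∑ k, energyWeight (m i) (μ i) (q i) k x * (S i *ᵥ z) k ^ 2)) := by
        gcongr
        exact h2.trans (by gcongr)
      _ ≤ c * (a * (M * ∑ k, energyWeight (m i) (μ i) (q i) k x * (S i *ᵥ z) k ^ 2)) := by
        gcongr
        exact hMb i
      _ = _ := by ring
  · have h2 : ∑ k, q i k * (S i *ᵥ z) k ^ 2 ≤ b * ∑ k, (S i *ᵥ z) k ^ 2 := by
      rw [Finset.mul_sum]
      exact Finset.sum_le_sum fun k _ =>
        mul_le_mul_of_nonneg_right (hbb (i, k)) (sq_nonneg _)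
    calc _ ≤ _ := sum_energyWeight_mul_sq_le (m i) (μ i) (hq i) hx (S i *ᵥ z)
      _ ≤ Real.exp (2 * |μ i|) * (b * (d * ∑ k, z k ^ 2)) := by
        gcongr
        exact h2.trans (by gcongr; exact hdb i z)
      _ ≤ M * (b * (d * ∑ k, z k ^ 2)) := by
        gcongr
        exact hMb i
      _ = _ := by ring

theorem integral_le_mul_integral {f g : ℝ → ℝ} {K : ℝ} (hf : ContinuousOn f (Icc 0 1))
    (hg : ContinuousOn g (Icc 0 1)) (h : ∀ x ∈ Icc (0:ℝ) 1, f x ≤ K * g x) :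
    ∫ x in (0:ℝ)..1, f x ≤ K * ∫ x in (0:ℝ)..1, g x := by
  rw [← intervalIntegral.integral_const_mul]
  exact intervalIntegral.integral_mono_on zero_le_one
    (hf.intervalIntegrable_of_Icc zero_le_one)
    ((continuousOn_const.mul hg).intervalIntegrable_of_Icc zero_le_one) h

/-- Theorem (mode dependent sign structure, average dwell time):
the numbers `m i` of negative characteristic velocities may depend on the mode; under the
mode-wise Lyapunov matrix inequalities with comparison constant γ, the switched linear
hyperbolic system is globally uniformly exponentially stable with respect to the class
𝒮_{τ_D,N₀} of switching signals with average dwell time τ_D > ln(γ)/(2ν) + Δ̄μ/ν, where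
Δ̄μ = 2|μ_i| if I is a singleton and Δ̄μ = 2 max_{i≠j}(|μ_i|+|μ_j|) otherwise.
A switching signal is encoded by its values `sig : ℝ → I` together with its set `times`
of switching times (its discontinuities), and a classical solution is a continuous
function which is C¹ and satisfies the PDE and boundary conditions of the active mode
on every interval free of switching times. -/
theorem stmt_8
    (n : ℕ) (hn : 1 ≤ n) (I : Type) [Fintype I] [Nonempty I] [DecidableEq I]
    (m : I → ℕ) (hm : ∀ i, m i ≤ n)
    (S : I → Matrix (Fin n) (Fin n) ℝ) (hS : ∀ i, IsUnit (S i))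
    (lam : I → Fin n → ℝ)
    (hlam : ∀ i (k : Fin n), if (k : ℕ) < m i then lam i k < 0 else 0 < lam i k)
    (A L F : I → Matrix (Fin n) (Fin n) ℝ)
    (hL : ∀ i, L i = (S i)⁻¹ * Matrix.diagonal (lam i) * S i)
    (hF : ∀ i, F i = S i * A i * (S i)⁻¹)
    (G : I → Matrix (Fin n) (Fin n) ℝ)
    (B0 B1 : I → Matrix (Fin n) (Fin n) ℝ)
    -- B⁰ᵢ = [[-Gᵢ₋₋, 0],[-Gᵢ₊₋, I]] Sᵢ  and  B¹ᵢ = [[I, -Gᵢ₋₊],[0, -Gᵢ₊₊]] Sᵢ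
    (hB0 : ∀ i, B0 i = (Matrix.of fun k l : Fin n =>
        if (l : ℕ) < m i then -(G i k l) else if k = l then (1:ℝ) else 0) * S i)
    (hB1 : ∀ i, B1 i = (Matrix.of fun k l : Fin n =>
        if (l : ℕ) < m i then (if k = l then (1:ℝ) else 0) else -(G i k l)) * S i)
    (ν γ : ℝ) (hν : 0 < ν) (hγ : 1 ≤ γ) (μ : I → ℝ)
    (q : I → Fin n → ℝ) (hq : ∀ i k, 0 < q i k)
    -- 𝒬ᵢ(x) = diag[e^{2μx} Qᵢ⁻, e^{-2μx} Qᵢ⁺]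
    (Qx : I → ℝ → Matrix (Fin n) (Fin n) ℝ)
    (hQx : ∀ i x, Qx i x = Matrix.diagonal (fun k : Fin n =>
        if (k : ℕ) < m i then Real.exp (2 * μ i * x) * q i k
        else Real.exp (-(2 * μ i * x)) * q i k))
    -- E₀ᵢ = [[I, 0],[Gᵢ₊₋, Gᵢ₊₊]],  E₁ᵢ = [[Gᵢ₋₋, Gᵢ₋₊],[0, I]]
    (E0 E1 : I → Matrix (Fin n) (Fin n) ℝ)
    (hE0 : ∀ i, E0 i = Matrix.of fun k l : Fin n =>
        if (k : ℕ) < m i then (if k = l then (1:ℝ) else 0) else G i k l)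
    (hE1 : ∀ i, E1 i = Matrix.of fun k l : Fin n =>
        if (k : ℕ) < m i then G i k l else if k = l then (1:ℝ) else 0)
    (hlmi1 : ∀ i, ∀ x ∈ Icc (0:ℝ) 1,
      matLE (-(2 * μ i) • (Qx i x * Matrix.diagonal (fun k => |lam i k|))
              + (F i)ᵀ * Qx i x + Qx i x * F i)
            (-(2 * ν) • Qx i x))
    (hlmi2 : ∀ i,
      matLE ((E0 i)ᵀ * (Qx i 0 * Matrix.diagonal (lam i)) * E0 i)
            ((E1 i)ᵀ * (Qx i 1 * Matrix.diagonal (lam i)) * E1 i))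
    -- SᵢᵀQᵢSᵢ ≤ γ SⱼᵀQⱼSⱼ
    (hleq : ∀ i j,
      matLE ((S i)ᵀ * Matrix.diagonal (q i) * S i)
            (γ • ((S j)ᵀ * Matrix.diagonal (q j) * S j))) :
    -- Δ̄μ = 2|μ_i| if I is a singleton, Δ̄μ = 2 max_{i≠j}(|μ_i|+|μ_j|) otherwise
    ∀ (N₀ : ℕ) (τD : ℝ),
      Real.log γ / (2 * ν)
          + (if h : (Finset.univ : Finset I).offDiag.Nonempty
              then 2 * Finset.sup' _ h (fun ij : I × I => |μ ij.1| + |μ ij.2|)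
              else 2 * |μ (Classical.arbitrary I)|) / ν < τD →
    ∃ ν' > (0:ℝ), ∃ C > (0:ℝ),
      ∀ (sig : ℝ → I) (times : Set ℝ),
        -- switching times are positive and locally finite
        (∀ t ∈ times, 0 < t) →
        (∀ T : ℝ, (times ∩ Icc 0 T).Finite) →
        -- `sig` is constant (hence right-continuous) between switching times
        (∀ s t : ℝ, 0 ≤ s → s ≤ t → (∀ u, s < u → u ≤ t → u ∉ times) → sig t = sig s) →
        -- switching times are genuine discontinuities of `sig`
        (∀ t ∈ times, ∀ ε > (0:ℝ), ∃ s, t - ε < s ∧ s < t ∧ sig s ≠ sig t) →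
        -- average dwell time condition: N_σ(τ,t) ≤ N₀ + (t-τ)/τD
        (∀ τ t : ℝ, 0 ≤ τ → τ < t →
          ((times ∩ Ioc τ t).ncard : ℝ) ≤ (N₀ : ℝ) + (t - τ) / τD) →
        ∀ w : ℝ → ℝ → Fin n → ℝ,
          -- `w` is continuous on [0,∞) × [0,1]
          ContinuousOn (fun pt : ℝ × ℝ => w pt.1 pt.2) (Ici (0:ℝ) ×ˢ Icc (0:ℝ) 1) →
          -- on every interval free of switching times, `w` is C¹ and satisfies the PDE
          -- and the boundary conditions of the active mode
          (∀ a b : ℝ, 0 ≤ a → a < b → (∀ u, a < u → u < b → u ∉ times) →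
            ContDiffOn ℝ 1 (fun pt : ℝ × ℝ => w pt.1 pt.2) (Icc a b ×ˢ Icc (0:ℝ) 1) ∧
            (∀ t ∈ Icc a b, ∀ x ∈ Icc (0:ℝ) 1,
              fderivWithin ℝ (fun pt : ℝ × ℝ => w pt.1 pt.2)
                  (Icc a b ×ˢ Icc (0:ℝ) 1) (t, x) (1, 0)
                + (L (sig a)).mulVec
                    (fderivWithin ℝ (fun pt : ℝ × ℝ => w pt.1 pt.2)
                      (Icc a b ×ˢ Icc (0:ℝ) 1) (t, x) (0, 1))
                = (A (sig a)).mulVec (w t x)) ∧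
            (∀ t ∈ Icc a b,
              (B0 (sig a)).mulVec (w t 0) + (B1 (sig a)).mulVec (w t 1) = 0)) →
          ∀ t ≥ (0:ℝ),
            Real.sqrt (∫ x in (0:ℝ)..1, ∑ k, (w t x k) ^ 2)
              ≤ C * Real.exp (-ν' * t) * Real.sqrt (∫ x in (0:ℝ)..1, ∑ k, (w 0 x k) ^ 2) := by
  intro N₀ τD hτ
  set Δ : ℝ := if h : (Finset.univ : Finset I).offDiag.Nonempty
    then 2 * Finset.sup' _ h (fun ij : I × I => |μ ij.1| + |μ ij.2|)
    else 2 * |μ (Classical.arbitrary I)| with hΔ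
  have hΔle : ∀ i j, i ≠ j → 2 * (|μ i| + |μ j|) ≤ Δ := by
    intro i j hij
    have hmem : (i, j) ∈ (Finset.univ : Finset I).offDiag := by simpa using hij
    rw [hΔ, dif_pos ⟨_, hmem⟩]
    have := Finset.le_sup' (fun ij : I × I => |μ ij.1| + |μ ij.2|) hmem
    simp only at this
    linarith
  have hΔ0 : 0 ≤ Δ := by
    by_cases h : (Finset.univ : Finset I).offDiag.Nonempty
    · obtain ⟨⟨i, j⟩, hij⟩ := h
      exact le_trans (by positivity) (hΔle i j (Finset.mem_offDiag.1 hij).2.2)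
    · rw [hΔ, dif_neg h]
      positivity
  have hlog : 0 ≤ Real.log γ := Real.log_nonneg hγ
  set κ : ℝ := Real.log γ + Δ with hκ
  have hκ0 : 0 ≤ κ := add_nonneg hlog hΔ0
  have hκτ : κ / (2 * ν) < τD := by
    refine lt_of_le_of_lt ?_ hτ
    rw [hκ, add_div]
    gcongr
    linarith
  have hτ0 : 0 < τD := lt_of_le_of_lt (by positivity) hκτ
  have hrate : 0 < ν - κ / (2 * τD) := by
    rw [div_lt_iff₀ (by positivity)] at hκτ
    rw [sub_pos, div_lt_iff₀ (by positivity)]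
    linarith
  obtain ⟨K₁, hK₁, K₂, hK₂, hK⟩ := exists_energy_equivalence m S hS μ q hq
  refine ⟨ν - κ / (2 * τD), hrate, Real.sqrt (K₁ * (Real.exp (κ * N₀) * K₂)),
    Real.sqrt_pos.2 (by positivity), ?_⟩
  intro sig times _ hfin hconst _ hdwell w hwc hw t ht
  have hwt : ∀ t, 0 ≤ t → ContinuousOn (fun x => w t x) (Icc 0 1) := fun t ht =>
    hwc.comp (f := fun x : ℝ => (t, x)) (by fun_prop) fun x hx => ⟨ht, hx⟩
  have hnc : ∀ t, 0 ≤ t → ContinuousOn (fun x => ∑ k, w t x k ^ 2) (Icc 0 1) := by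
    intro t ht
    have := hwt t ht
    fun_prop
  have hec : ∀ i t, 0 ≤ t → ContinuousOn
      (fun x => ∑ k, energyWeight (m i) (μ i) (q i) k x * (S i *ᵥ w t x) k ^ 2) (Icc 0 1) := by
    intro i t ht
    have h1 := hwt t ht
    have h2 := continuous_energyWeight (m i) (μ i) (q i)
    simp only [Matrix.mulVec, dotProduct]
    fun_prop
  set V : I → ℝ → ℝ := fun i t =>
    ∫ x in (0:ℝ)..1, ∑ k, energyWeight (m i) (μ i) (q i) k x * (S i *ᵥ w t x) k ^ 2 with hV
  have hmode : ∀ s t, 0 ≤ s → s < t → (∀ u, s < u → u < t → u ∉ times) →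
      V (sig s) t ≤ Real.exp (-(2 * ν * (t - s))) * V (sig s) s := by
    intro s t hs hst hfree
    obtain ⟨h1, h2, h3⟩ := hw s t hs hst hfree
    have hQ : ∀ i x, Qx i x =
        Matrix.diagonal (fun k => energyWeight (m i) (μ i) (q i) k x) := fun i x => hQx i x
    have hl1 := hlmi1 (sig s)
    have hl2 := hlmi2 (sig s)
    simp only [hQ] at hl1 hl2
    exact mode_energy_decay (hS _) (hlam _) (hL _) (hF _) (hB0 _) (hB1 _) (hE0 _) (hE1 _)
      hl1 hl2 hst.le h1 h2 h3
  have hswitch : ∀ i j t, 0 ≤ t → V i t ≤ Real.exp κ * V j t := by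
    intro i j t ht
    refine integral_le_mul_integral (hec i t ht) (hec j t ht) fun x hx => ?_
    have hnn : 0 ≤ ∑ k, energyWeight (m j) (μ j) (q j) k x * (S j *ᵥ w t x) k ^ 2 :=
      nonneg_of_mul_nonneg_right
        ((Finset.sum_nonneg fun k _ => sq_nonneg (w t x k)).trans (hK j x hx (w t x)).1) hK₁
    by_cases hij : i = j
    · subst hij
      exact le_mul_of_one_le_left hnn (Real.one_le_exp hκ0)
    · refine (sum_energyWeight_le_jump (m₂ := m j) (μ₂ := μ j) (hq i) (hq j) (by linarith)
        (hleq i j) hx _).trans ?_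
      gcongr
      linarith [hΔle i j hij]
  have hiter := le_of_decay_between_of_jump (V := fun t => V (sig t) t) (c := 2 * ν) (κ := κ) hfin
    (fun s t hs hst hfree => by
      have hsig : sig t = sig s := hconst s t hs hst hfree
      rcases hst.eq_or_lt with rfl | hlt
      · simp
      · simp only [hsig]
        exact hmode s t hs hlt fun u h1 h2 => hfree u h1 h2.le)
    (fun s t hs hst hfree => by
      refine (hswitch (sig t) (sig s) t (hs.trans hst.le)).trans ?_
      rw [mul_assoc]
      exact mul_le_mul_of_nonneg_left (hmode s t hs hst hfree) (Real.exp_pos _).le)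
    _ 0 t le_rfl ht rfl
  have hN : ((times ∩ Ioc 0 t).ncard : ℝ) ≤ N₀ + t / τD := by
    rcases ht.eq_or_lt with rfl | hlt
    · simp
    · simpa using hdwell 0 t le_rfl hlt
  have hlow : ∫ x in (0:ℝ)..1, ∑ k, w t x k ^ 2 ≤ K₁ * V (sig t) t :=
    integral_le_mul_integral (hnc t ht) (hec _ t ht) fun x hx => (hK _ x hx _).1
  have hup : V (sig 0) 0 ≤ K₂ * ∫ x in (0:ℝ)..1, ∑ k, w 0 x k ^ 2 :=
    integral_le_mul_integral (hec _ 0 le_rfl) (hnc 0 le_rfl) fun x hx => (hK _ x hx _).2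
  set J : ℝ := ∫ x in (0:ℝ)..1, ∑ k, w 0 x k ^ 2 with hJ
  have hJ0 : 0 ≤ J := intervalIntegral.integral_nonneg zero_le_one
    fun x _ => Finset.sum_nonneg fun k _ => sq_nonneg _
  have hexp : Real.exp (κ * (times ∩ Ioc 0 t).ncard) * Real.exp (-(2 * ν * (t - 0))) ≤
      Real.exp (κ * N₀) * Real.exp (-(ν - κ / (2 * τD)) * t) ^ 2 := by
    rw [← Real.exp_nat_mul, ← Real.exp_add, ← Real.exp_add, Real.exp_le_exp]
    have h1 := mul_le_mul_of_nonneg_left hN hκ0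
    have h2 : κ * (N₀ + t / τD) = κ * N₀ + 2 * (κ / (2 * τD)) * t := by
      field_simp
    push_cast
    linarith
  have hfinal : ∫ x in (0:ℝ)..1, ∑ k, w t x k ^ 2 ≤
      K₁ * (Real.exp (κ * N₀) * K₂) * Real.exp (-(ν - κ / (2 * τD)) * t) ^ 2 * J :=
    calc _ ≤ K₁ * V (sig t) t := hlow
      _ ≤ K₁ * (Real.exp (κ * (times ∩ Ioc 0 t).ncard) * Real.exp (-(2 * ν * (t - 0))) *
          V (sig 0) 0) := by gcongr
      _ ≤ K₁ * (Real.exp (κ * (times ∩ Ioc 0 t).ncard) * Real.exp (-(2 * ν * (t - 0))) *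
          (K₂ * J)) := by gcongr
      _ ≤ K₁ * (Real.exp (κ * N₀) * Real.exp (-(ν - κ / (2 * τD)) * t) ^ 2 * (K₂ * J)) := by
        gcongr
      _ = _ := by ring
  calc _ ≤ _ := Real.sqrt_le_sqrt hfinal
    _ = _ := by
      rw [Real.sqrt_mul (by positivity), Real.sqrt_mul (by positivity),
        Real.sqrt_sq (Real.exp_pos _).le]
end
end

section
/- Let I be a finite nonempty set, and for each i ∈ I let T_i ∈ ℝ^{p×n} be a matrix and Q_i ∈ ℝ^{p×p} a diagonal positive definite matrix. Then there exists γ ≥ 1 such that T_iᵀQ_iT_i ≤ γ T_jᵀQ_jT_j for all i, j ∈ I if and only if ker T_i = ker T_j for all i, j ∈ I. In particular, for real positive semidefinite matrices A = T_iᵀQ_iT_i and B = T_jᵀQ_jT_j, the existence of γ > 0 with A ≤ γB is equivalent to ker B ⊆ ker A. -/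
open Matrix Set Real

noncomputable section

open scoped MatrixOrder

theorem LinearMap.exists_comp_eq_of_ker_le_ker {K V W U : Type*} [Field K]
    [AddCommGroup V] [Module K V] [AddCommGroup W] [Module K W] [AddCommGroup U] [Module K U]
    (f : V →ₗ[K] W) (g : V →ₗ[K] U) (h : LinearMap.ker g ≤ LinearMap.ker f) :
    ∃ c : U →ₗ[K] W, c ∘ₗ g = f := by
  obtain ⟨l, hl⟩ := ((LinearMap.ker g).liftQ g le_rfl).exists_leftInverse_of_injective
    (Submodule.ker_liftQ_eq_bot _ _ _ le_rfl)
  refine ⟨(LinearMap.ker g).liftQ f h ∘ₗ l, LinearMap.ext fun x ↦ ?_⟩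
  have hx : l (g x) = Submodule.Quotient.mk x :=
    LinearMap.congr_fun hl (Submodule.Quotient.mk x)
  simp [hx]

theorem Matrix.dotProduct_mulVec_self_le {m k : Type*} [Fintype m] [Fintype k]
    (C : Matrix m k ℝ) (y : k → ℝ) :
    C *ᵥ y ⬝ᵥ C *ᵥ y ≤ (∑ i, ∑ j, C i j ^ 2) * (y ⬝ᵥ y) := by
  simp only [dotProduct, mulVec, ← sq, Finset.sum_mul]
  gcongr with i
  rw [← Finset.sum_mul]
  exact Finset.sum_mul_sq_le_sq_mul_sq _ _ _

section Loewner

variable {ι : Type*} [Fintype ι] {A B : Matrix ι ι ℝ}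

theorem matLE_iff_dotProduct_le (hA : A.PosSemidef) (hB : B.PosSemidef) :
    matLE A B ↔ ∀ x, x ⬝ᵥ A *ᵥ x ≤ x ⬝ᵥ B *ᵥ x := by
  rw [matLE, posSemidef_iff_dotProduct_mulVec, and_iff_right (hB.isHermitian.sub hA.isHermitian)]
  simp [sub_mulVec, dotProduct_sub]

theorem ker_le_ker_of_matLE_smul (hA : A.PosSemidef) {γ : ℝ}
    (h : matLE A (γ • B)) : LinearMap.ker B.mulVecLin ≤ LinearMap.ker A.mulVecLin := by
  intro x hx
  rw [LinearMap.mem_ker, mulVecLin_apply] at hx ⊢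
  rw [← hA.dotProduct_mulVec_zero_iff]
  refine le_antisymm ?_ (hA.dotProduct_mulVec_nonneg x)
  simpa [sub_mulVec, smul_mulVec, hx] using h.dotProduct_mulVec_nonneg x

theorem exists_matLE_smul_of_ker_le_ker (hA : A.PosSemidef) (hB : B.PosSemidef)
    (h : LinearMap.ker B.mulVecLin ≤ LinearMap.ker A.mulVecLin) :
    ∃ γ : ℝ, 0 < γ ∧ matLE A (γ • B) := by
  classical
  obtain ⟨M, rfl⟩ := CStarAlgebra.nonneg_iff_eq_star_mul_self.mp hA.nonneg
  obtain ⟨N, rfl⟩ := CStarAlgebra.nonneg_iff_eq_star_mul_self.mp hB.nonneg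
  rw [star_eq_conjTranspose, star_eq_conjTranspose, ker_mulVecLin_conjTranspose_mul_self,
    ker_mulVecLin_conjTranspose_mul_self] at h
  obtain ⟨c, hc⟩ := LinearMap.exists_comp_eq_of_ker_le_ker _ _ h
  set C := LinearMap.toMatrix' c
  have hC (x : ι → ℝ) : M *ᵥ x = C *ᵥ (N *ᵥ x) := by
    rw [LinearMap.toMatrix'_mulVec]
    exact (LinearMap.congr_fun hc x).symm
  have quad (L : Matrix ι ι ℝ) (x : ι → ℝ) :
      x ⬝ᵥ (star L * L) *ᵥ x = L *ᵥ x ⬝ᵥ L *ᵥ x := by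
    rw [← mulVec_mulVec, dotProduct_mulVec, star_eq_conjTranspose,
      conjTranspose_eq_transpose_of_trivial, vecMul_transpose]
  refine ⟨(∑ i, ∑ j, C i j ^ 2) + 1, by positivity, ?_⟩
  rw [matLE_iff_dotProduct_le hA (hB.smul (by positivity))]
  intro x
  rw [smul_mulVec, dotProduct_smul, quad, quad, hC, smul_eq_mul]
  have := C.dotProduct_mulVec_self_le (N *ᵥ x)
  have hN : 0 ≤ N *ᵥ x ⬝ᵥ N *ᵥ x := Finset.sum_nonneg fun i _ ↦ mul_self_nonneg _
  linarith

theorem matLE_smul_mono (hB : B.PosSemidef) {γ δ : ℝ} (hγδ : γ ≤ δ) (h : matLE A (γ • B)) :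
    matLE A (δ • B) := by
  have := h.add (hB.smul (sub_nonneg.mpr hγδ))
  rwa [sub_smul, sub_add_sub_comm, add_comm A, add_sub_add_comm, sub_self, zero_add] at this

end Loewner

section WeightedGram

variable {m k : Type*} [Fintype m] [DecidableEq m] [Fintype k]

theorem posSemidef_transpose_mul_diagonal_mul (T : Matrix m k ℝ) {q : m → ℝ} (hq : ∀ i, 0 < q i) :
    (Tᵀ * diagonal q * T).PosSemidef := by
  simpa using (PosSemidef.diagonal fun i ↦ (hq i).le).conjTranspose_mul_mul_same T

theorem ker_transpose_mul_diagonal_mul (T : Matrix m k ℝ) {q : m → ℝ} (hq : ∀ i, 0 < q i) :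
    LinearMap.ker (Tᵀ * diagonal q * T).mulVecLin = LinearMap.ker T.mulVecLin := by
  ext x
  simp only [LinearMap.mem_ker, mulVecLin_apply]
  refine ⟨fun h ↦ ?_, fun h ↦ by rw [← mulVec_mulVec, h, mulVec_zero]⟩
  by_contra hx
  have hpos := (PosDef.diagonal hq).dotProduct_mulVec_pos hx
  rw [star_trivial, ← vecMul_transpose, ← dotProduct_mulVec, vecMul_transpose, mulVec_mulVec,
    mulVec_mulVec, h, dotProduct_zero] at hpos
  exact hpos.false

end WeightedGram

/-- A uniform comparison constant `γ ≥ 1` with `TᵢᵀQᵢTᵢ ≤ γ TⱼᵀQⱼTⱼ` for all `i,j` exists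
iff all the kernels `ker Tᵢ` coincide; and for positive semidefinite `A = TᵢᵀQᵢTᵢ`,
`B = TⱼᵀQⱼTⱼ` (in fact for any real positive semidefinite matrices), the existence of
`γ > 0` with `A ≤ γB` is equivalent to `ker B ⊆ ker A`. -/
theorem stmt_9
    (n p : ℕ) (I : Type) [Fintype I] [Nonempty I]
    (T : I → Matrix (Fin p) (Fin n) ℝ)
    (q : I → Fin p → ℝ) (hq : ∀ i k, 0 < q i k) :
    ((∃ γ : ℝ, 1 ≤ γ ∧ ∀ i j : I,
        matLE ((T i)ᵀ * Matrix.diagonal (q i) * T i)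
              (γ • ((T j)ᵀ * Matrix.diagonal (q j) * T j)))
      ↔ ∀ i j : I, LinearMap.ker (T i).mulVecLin = LinearMap.ker (T j).mulVecLin)
    ∧
    (∀ A B : Matrix (Fin n) (Fin n) ℝ, A.PosSemidef → B.PosSemidef →
      ((∃ γ : ℝ, 0 < γ ∧ matLE A (γ • B))
        ↔ LinearMap.ker B.mulVecLin ≤ LinearMap.ker A.mulVecLin)) := by
  have hpsd (i : I) := posSemidef_transpose_mul_diagonal_mul (T i) (hq i)
  have hker (i : I) := ker_transpose_mul_diagonal_mul (T i) (hq i)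
  refine ⟨⟨?_, fun h ↦ ?_⟩, fun A B hA hB ↦
    ⟨fun ⟨_, _, h⟩ ↦ ker_le_ker_of_matLE_smul hA h, exists_matLE_smul_of_ker_le_ker hA hB⟩⟩
  · rintro ⟨γ, -, h⟩ i j
    rw [← hker i, ← hker j]
    exact le_antisymm (ker_le_ker_of_matLE_smul (hpsd j) (h j i))
      (ker_le_ker_of_matLE_smul (hpsd i) (h i j))
  · have hex (i j : I) := exists_matLE_smul_of_ker_le_ker (hpsd i) (hpsd j)
      (by rw [hker, hker, h i j])
    choose g hg hle using hex
    have hg' (i j : I) : 0 ≤ g i j := (hg i j).le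
    refine ⟨1 + ∑ i, ∑ j, g i j, le_add_of_nonneg_right
      (Finset.sum_nonneg fun i _ ↦ Finset.sum_nonneg fun j _ ↦ hg' i j), fun i j ↦
      matLE_smul_mono (hpsd j) ?_ (hle i j)⟩
    calc g i j ≤ ∑ j, g i j := Finset.single_le_sum (fun j _ ↦ hg' i j) (Finset.mem_univ j)
      _ ≤ ∑ i, ∑ j, g i j := Finset.single_le_sum (f := fun i ↦ ∑ j, g i j)
          (fun i _ ↦ Finset.sum_nonneg fun j _ ↦ hg' i j) (Finset.mem_univ i)
      _ ≤ 1 + ∑ i, ∑ j, g i j := le_add_of_nonneg_left zero_le_one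
end
end

section
/- Assume m_i = m for all i ∈ I, and that there exist ν > 0 and diagonal positive definite matrices Q_i = diag[Q_i⁻, Q_i⁺] ∈ ℝ^{n×n} such that for all i ∈ I: F_iᵀQ_i + Q_iF_i ≤ −2νIₙ, Q_i ≤ Iₙ, and E₀ᵢᵀ Q_i Λ_i E₀ᵢ ≤ E₁ᵢᵀ Q_i Λ_i E₁ᵢ where E₀ᵢ = [[I_m, 0],[G_{i+−}, G_{i++}]] and E₁ᵢ = [[G_{i−−}, G_{i−+}],[0, I_{n−m}]], together with (S_i⁺)ᵀQ_i⁺S_i⁺ = (S_j⁺)ᵀQ_j⁺S_j⁺ and (S_i⁻)ᵀQ_i⁻S_i⁻ = (S_j⁻)ᵀQ_j⁻S_j⁻ for all i,j ∈ I. Then the switched linear hyperbolic system is globally uniformly exponentially stable with respect to the set of all switching signals: there exist ν' > 0 and C > 0 such that for every switching signal σ and every classical solution w, ‖w(t,·)‖_{L²((0,1);ℝⁿ)} ≤ C e^{−ν't} ‖w(0,·)‖_{L²((0,1);ℝⁿ)} for all t ≥ 0. -/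
open Matrix Set Real

noncomputable section

theorem matLE.dotProduct_mulVec_le_s10 {ι : Type*} [Fintype ι] {A B : Matrix ι ι ℝ}
    (h : matLE A B) (v : ι → ℝ) : v ⬝ᵥ A *ᵥ v ≤ v ⬝ᵥ B *ᵥ v := by
  have := Matrix.PosSemidef.dotProduct_mulVec_nonneg h v
  rw [star_trivial, sub_mulVec, dotProduct_sub] at this
  linarith

/-- Quadratic form of `Mᵀ diag(c) M`. -/
theorem dotProduct_transpose_diagonal_mulVec {ι : Type*} [Fintype ι] [DecidableEq ι]
    (M : Matrix ι ι ℝ) (c v : ι → ℝ) :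
    v ⬝ᵥ (Mᵀ * diagonal c * M) *ᵥ v = ∑ k, c k * (M *ᵥ v) k ^ 2 := by
  rw [Matrix.mul_assoc, ← mulVec_mulVec, ← mulVec_mulVec, dotProduct_mulVec, vecMul_transpose]
  simp only [dotProduct, mulVec_diagonal]
  exact Finset.sum_congr rfl fun k _ => by ring

theorem sum_sq_mulVec_le {ι : Type*} [Fintype ι] (M : Matrix ι ι ℝ) (v : ι → ℝ) :
    ∑ k, (M *ᵥ v) k ^ 2 ≤ (∑ k, ∑ l, M k l ^ 2) * ∑ k, v k ^ 2 := by
  rw [Finset.sum_mul]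
  exact Finset.sum_le_sum fun k _ => Finset.sum_mul_sq_le_sq_mul_sq _ _ _

theorem hasFDerivAt_exp_mul_sum_sq {ι : Type*} [Fintype ι] (ν : ℝ) (c : ι → ℝ)
    {y : ℝ × ℝ → ι → ℝ} {D : ℝ × ℝ →L[ℝ] ι → ℝ} {p : ℝ × ℝ} (hD : HasFDerivAt y D p) :
    HasFDerivAt (fun p => exp (2 * ν * p.1) * ∑ k, c k * y p k ^ 2)
      (exp (2 * ν * p.1) •
          (∑ k, (2 * c k * y p k) • (ContinuousLinearMap.proj (R := ℝ) k).comp D)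
        + (∑ k, c k * y p k ^ 2) •
          ((exp (2 * ν * p.1) * (2 * ν)) • ContinuousLinearMap.fst ℝ ℝ ℝ)) p := by
  refine HasFDerivAt.mul ?_ ?_
  · have h1 : HasFDerivAt (fun p : ℝ × ℝ => 2 * ν * p.1)
        ((2 * ν) • ContinuousLinearMap.fst ℝ ℝ ℝ) p := hasFDerivAt_fst.const_mul (2 * ν)
    simpa [smul_smul] using h1.exp
  · refine HasFDerivAt.fun_sum fun k _ => ?_
    have h2 : HasFDerivAt (fun p => y p k) ((ContinuousLinearMap.proj (R := ℝ) k).comp D) p :=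
      (hasFDerivAt_pi'.1 hD) k
    have h3 := (h2.pow 2).const_mul (c k)
    refine h3.congr_fderiv (ContinuousLinearMap.ext fun d => ?_)
    simp
    ring

/-- Decay of the weighted energy of a diagonal hyperbolic system on `[a, b] × [0, 1]`, obtained
from the divergence theorem. -/
theorem exp_mul_energy_le {ι : Type*} [Fintype ι] {a b ν : ℝ} (hab : a ≤ b) (q lam : ι → ℝ)
    (F : Matrix ι ι ℝ) (y : ℝ × ℝ → ι → ℝ) (D : ℝ × ℝ → ℝ × ℝ →L[ℝ] ι → ℝ)
    (hy : ContinuousOn y (Icc a b ×ˢ Icc 0 1))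
    (hD : ∀ p ∈ Ioo a b ×ˢ Ioo (0 : ℝ) 1, HasFDerivAt y (D p) p)
    (hpde : ∀ p ∈ Icc a b ×ˢ Icc (0 : ℝ) 1, ∀ k,
      D p (1, 0) k + lam k * D p (0, 1) k = (F *ᵥ y p) k)
    (hF : ∀ v : ι → ℝ, ∑ k, q k * (v k * (F *ᵥ v) k) ≤ -ν * ∑ k, q k * v k ^ 2)
    (hbd : ∀ t ∈ Icc a b,
      ∑ k, q k * lam k * y (t, 0) k ^ 2 ≤ ∑ k, q k * lam k * y (t, 1) k ^ 2) :
    exp (2 * ν * b) * ∫ x in (0 : ℝ)..1, ∑ k, q k * y (b, x) k ^ 2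
      ≤ exp (2 * ν * a) * ∫ x in (0 : ℝ)..1, ∑ k, q k * y (a, x) k ^ 2 := by
  have hyk : ∀ k, ContinuousOn (fun p => y p k) (Icc a b ×ˢ Icc (0 : ℝ) 1) :=
    fun k => continuousOn_pi.1 hy k
  have hcont : ∀ c : ι → ℝ, ContinuousOn (fun p : ℝ × ℝ => exp (2 * ν * p.1) *
      ∑ k, c k * y p k ^ 2) (Icc a b ×ˢ Icc (0 : ℝ) 1) := fun c => by fun_prop
  have hbox : Icc (a, (0 : ℝ)) (b, 1) = Icc a b ×ˢ Icc (0 : ℝ) 1 := (Icc_prod_eq _ _)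
  set h : ℝ × ℝ → ℝ := fun p => exp (2 * ν * p.1) *
    (2 * (∑ k, q k * (y p k * (F *ᵥ y p) k) + ν * ∑ k, q k * y p k ^ 2)) with hh
  have hdiv : ∀ p ∈ Icc a b ×ˢ Icc (0 : ℝ) 1,
      (exp (2 * ν * p.1) •
          (∑ k, (2 * q k * y p k) • (ContinuousLinearMap.proj (R := ℝ) k).comp (D p))
        + (∑ k, q k * y p k ^ 2) •
          ((exp (2 * ν * p.1) * (2 * ν)) • ContinuousLinearMap.fst ℝ ℝ ℝ)) (1, 0) +
      (exp (2 * ν * p.1) •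
          (∑ k, (2 * (q k * lam k) * y p k) • (ContinuousLinearMap.proj (R := ℝ) k).comp (D p))
        + (∑ k, q k * lam k * y p k ^ 2) •
          ((exp (2 * ν * p.1) * (2 * ν)) • ContinuousLinearMap.fst ℝ ℝ ℝ)) (0, 1) = h p := by
    intro p hp
    simp only [hh, ← hpde p hp]
    simp only [_root_.add_apply, _root_.smul_apply, _root_.sum_apply,
      ContinuousLinearMap.comp_apply, ContinuousLinearMap.proj_apply,
      ContinuousLinearMap.coe_fst', smul_eq_mul]
    have : ∑ k, q k * (y p k * (D p (1, 0) k + lam k * D p (0, 1) k))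
        = (∑ k, 2 * q k * y p k * D p (1, 0) k
            + ∑ k, 2 * (q k * lam k) * y p k * D p (0, 1) k) / 2 := by
      rw [← Finset.sum_add_distrib, Finset.sum_div]
      exact Finset.sum_congr rfl fun k _ => by ring
    rw [this]
    ring
  have hhc : ContinuousOn h (Icc a b ×ˢ Icc (0 : ℝ) 1) := by
    simp only [hh, mulVec, dotProduct]
    fun_prop
  have key := MeasureTheory.integral_divergence_prod_Icc_of_hasFDerivAt_of_le
    (fun p => exp (2 * ν * p.1) * ∑ k, q k * y p k ^ 2)
    (fun p => exp (2 * ν * p.1) * ∑ k, q k * lam k * y p k ^ 2) _ _ (a, 0) (b, 1)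
    ⟨hab, zero_le_one⟩ (hbox ▸ hcont _) (hbox ▸ hcont _)
    (fun p hp => hasFDerivAt_exp_mul_sum_sq ν _ (hD p hp))
    (fun p hp => hasFDerivAt_exp_mul_sum_sq ν _ (hD p hp))
    (by
      rw [hbox]
      exact (hhc.integrableOn_compact (isCompact_Icc.prod isCompact_Icc)).congr_fun
        (fun p hp => (hdiv p hp).symm) (measurableSet_Icc.prod measurableSet_Icc))
  have hle : (∫ p in Icc (a, (0 : ℝ)) (b, 1), h p) ≤ 0 :=
    MeasureTheory.integral_nonpos fun p =>
      mul_nonpos_of_nonneg_of_nonpos (exp_nonneg _) (by linarith [hF (y p)])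
  rw [MeasureTheory.setIntegral_congr_fun measurableSet_Icc
    (fun p hp => hdiv p (hbox ▸ hp))] at key
  have hside : ∀ x ∈ Icc (0 : ℝ) 1, IntervalIntegrable
      (fun t => exp (2 * ν * t) * ∑ k, q k * lam k * y (t, x) k ^ 2)
      MeasureTheory.volume a b := fun x hx =>
    ContinuousOn.intervalIntegrable (by
      rw [uIcc_of_le hab]
      exact (hcont fun k => q k * lam k).comp (f := fun t => (t, x)) (by fun_prop)
        fun t ht => ⟨ht, hx⟩)
  have hmono := intervalIntegral.integral_mono_on hab (hside 0 (by simp)) (hside 1 (by simp))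
    fun t ht => mul_le_mul_of_nonneg_left (hbd t ht) (exp_nonneg _)
  simp only [intervalIntegral.integral_const_mul] at key hmono ⊢
  linarith

/-- A function that does not increase across any gap of a locally finite set is nonincreasing. -/
theorem le_of_le_on_gaps {times : Set ℝ} (hfin : ∀ T : ℝ, (times ∩ Icc 0 T).Finite) {V : ℝ → ℝ}
    (hgap : ∀ a b : ℝ, 0 ≤ a → a < b → (∀ u, a < u → u < b → u ∉ times) → V b ≤ V a)
    {a b : ℝ} (ha : 0 ≤ a) (hab : a ≤ b) : V b ≤ V a := by
  have hf : ∀ {a b : ℝ}, 0 ≤ a → (times ∩ Ioo a b).Finite := fun {a b} ha =>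
    (hfin b).subset (inter_subset_inter_right _ fun u hu => ⟨ha.trans hu.1.le, hu.2.le⟩)
  induction hN : (times ∩ Ioo a b).ncard using Nat.strong_induction_on generalizing a b with
  | _ N ih =>
    subst hN
    rcases hab.eq_or_lt with rfl | hlt
    · exact le_rfl
    by_cases hempty : ∀ u, a < u → u < b → u ∉ times
    · exact hgap a b ha hlt hempty
    push Not at hempty
    obtain ⟨u, hau, hub, hu⟩ := hempty
    have h1 : V b ≤ V u := by
      refine ih _ ?_ (ha.trans hau.le) hub.le rfl
      refine ncard_lt_ncard ⟨inter_subset_inter_right _ (Ioo_subset_Ioo_left hau.le), ?_⟩ (hf ha)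
      exact fun h => lt_irrefl u (h ⟨hu, hau, hub⟩).2.1
    have h2 : V u ≤ V a := by
      refine ih _ ?_ ha hau.le rfl
      refine ncard_lt_ncard ⟨inter_subset_inter_right _ (Ioo_subset_Ioo_right hub.le), ?_⟩ (hf ha)
      exact fun h => lt_irrefl u (h ⟨hu, hau, hub⟩).2.2
    exact h1.trans h2

/-- The boundary conditions, together with the boundary matrix inequality, make the energy flux
at `0` at most the flux at `1`. -/
theorem boundary_flux_le {n m : ℕ} (G E0 E1 : Matrix (Fin n) (Fin n) ℝ) (q lam : Fin n → ℝ)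
    (hE0 : E0 = Matrix.of fun k l : Fin n =>
        if (k : ℕ) < m then (if k = l then (1:ℝ) else 0) else G k l)
    (hE1 : E1 = Matrix.of fun k l : Fin n =>
        if (k : ℕ) < m then G k l else if k = l then (1:ℝ) else 0)
    (hlmi : matLE (E0ᵀ * (diagonal q * diagonal lam) * E0) (E1ᵀ * (diagonal q * diagonal lam) * E1))
    {u v : Fin n → ℝ}
    (huv : (Matrix.of fun k l : Fin n =>
          if (l : ℕ) < m then -(G k l) else if k = l then (1:ℝ) else 0) *ᵥ u
        + (Matrix.of fun k l : Fin n =>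
          if (l : ℕ) < m then (if k = l then (1:ℝ) else 0) else -(G k l)) *ᵥ v = 0) :
    ∑ k, q k * lam k * u k ^ 2 ≤ ∑ k, q k * lam k * v k ^ 2 := by
  set z : Fin n → ℝ := fun k => if (k : ℕ) < m then u k else v k with hz
  have hG : ∀ k, (G *ᵥ z) k = if (k : ℕ) < m then v k else u k := by
    intro k
    have hk := congrFun huv k
    simp only [Pi.add_apply, mulVec, dotProduct, of_apply, Pi.zero_apply,
      ← Finset.sum_add_distrib] at hk
    have hterm : ∀ l : Fin n,
        (if (l : ℕ) < m then -(G k l) else if k = l then (1:ℝ) else 0) * u l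
          + (if (l : ℕ) < m then (if k = l then (1:ℝ) else 0) else -(G k l)) * v l
        = (if k = l then (if (l : ℕ) < m then v l else u l) else 0) - G k l * z l := by
      intro l
      by_cases hl : (l : ℕ) < m <;> by_cases hkl : k = l <;> simp [hz, hl, hkl] <;> ring
    rw [Finset.sum_congr rfl fun l _ => hterm l, Finset.sum_sub_distrib] at hk
    simp only [Finset.sum_ite_eq, Finset.mem_univ, if_true] at hk
    simp only [mulVec, dotProduct]
    linarith
  have hu : E0 *ᵥ z = u := by
    ext k
    by_cases hk : (k : ℕ) < m
    · have : z k = u k := if_pos hk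
      simpa [hE0, mulVec, dotProduct, hk] using this
    · simpa [hE0, mulVec, dotProduct, hk] using hG k
  have hv : E1 *ᵥ z = v := by
    ext k
    by_cases hk : (k : ℕ) < m
    · simpa [hE1, mulVec, dotProduct, hk] using hG k
    · have : z k = v k := if_neg hk
      simpa [hE1, mulVec, dotProduct, hk] using this
  have := hlmi.dotProduct_mulVec_le_s10 z
  rwa [diagonal_mul_diagonal, dotProduct_transpose_diagonal_mulVec,
    dotProduct_transpose_diagonal_mulVec, hu, hv] at this

/-- Dissipation from the Lyapunov matrix inequalities `FᵀQ + QF ≤ -2ν`, `Q ≤ 1`. -/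
theorem sum_mul_mulVec_le {ι : Type*} [Fintype ι] [DecidableEq ι] {ν : ℝ} (hν : 0 < ν)
    {F : Matrix ι ι ℝ} {q : ι → ℝ}
    (hF : matLE (Fᵀ * diagonal q + diagonal q * F) (-(2 * ν) • (1 : Matrix ι ι ℝ)))
    (hq : matLE (diagonal q) (1 : Matrix ι ι ℝ)) (v : ι → ℝ) :
    ∑ k, q k * (v k * (F *ᵥ v) k) ≤ -ν * ∑ k, q k * v k ^ 2 := by
  have h1 := hF.dotProduct_mulVec_le_s10 v
  have h2 := hq.dotProduct_mulVec_le_s10 v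
  rw [add_mulVec, dotProduct_add, ← mulVec_mulVec, ← mulVec_mulVec, dotProduct_mulVec,
    vecMul_transpose, smul_mulVec, one_mulVec, dotProduct_smul, smul_eq_mul] at h1
  rw [one_mulVec] at h2
  have e1 : (F *ᵥ v) ⬝ᵥ (diagonal q *ᵥ v) = ∑ k, q k * (v k * (F *ᵥ v) k) := by
    simp only [dotProduct, mulVec_diagonal]
    exact Finset.sum_congr rfl fun k _ => by ring
  have e2 : v ⬝ᵥ (diagonal q *ᵥ (F *ᵥ v)) = ∑ k, q k * (v k * (F *ᵥ v) k) := by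
    simp only [dotProduct, mulVec_diagonal]
    exact Finset.sum_congr rfl fun k _ => by ring
  have e3 : v ⬝ᵥ (diagonal q *ᵥ v) = ∑ k, q k * v k ^ 2 := by
    simp only [dotProduct, mulVec_diagonal]
    exact Finset.sum_congr rfl fun k _ => by ring
  rw [e1, e2] at h1
  rw [e3] at h2
  nlinarith [mul_le_mul_of_nonneg_left h2 hν.le]

/-- Equivalence of the Euclidean norm with the norm weighted by `Sᵀ diag(q) S`. -/
theorem exists_energy_equiv {ι : Type*} [Fintype ι] [DecidableEq ι] {S : Matrix ι ι ℝ}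
    (hS : IsUnit S) {q : ι → ℝ} (hq : ∀ k, 0 < q k) :
    ∃ c > (0 : ℝ), ∃ d > (0 : ℝ), ∀ v : ι → ℝ,
      ∑ k, v k ^ 2 ≤ c * ∑ k, q k * (S *ᵥ v) k ^ 2 ∧
      ∑ k, q k * (S *ᵥ v) k ^ 2 ≤ d * ∑ k, v k ^ 2 := by
  have hsq : ∀ M : Matrix ι ι ℝ, 0 ≤ ∑ k, ∑ l, M k l ^ 2 := fun M =>
    Finset.sum_nonneg fun _ _ => Finset.sum_nonneg fun _ _ => sq_nonneg _
  set R : Matrix ι ι ℝ := diagonal (fun k => √(q k)) * S with hR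
  set T : Matrix ι ι ℝ := S⁻¹ * diagonal (fun k => (√(q k))⁻¹) with hT
  have hRv : ∀ v : ι → ℝ, ∑ k, q k * (S *ᵥ v) k ^ 2 = ∑ k, (R *ᵥ v) k ^ 2 := fun v =>
    Finset.sum_congr rfl fun k _ => by
      rw [hR, ← mulVec_mulVec, mulVec_diagonal, mul_pow, sq_sqrt (hq k).le]
  have hTR : T * R = 1 := by
    rw [hT, hR, Matrix.mul_assoc, ← Matrix.mul_assoc (diagonal _), diagonal_mul_diagonal]
    simp_rw [inv_mul_cancel₀ (sqrt_pos.2 (hq _)).ne']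
    rw [diagonal_one, Matrix.one_mul, nonsing_inv_mul _ ((isUnit_iff_isUnit_det S).1 hS)]
  refine ⟨_, add_pos_of_nonneg_of_pos (hsq T) one_pos, _,
    add_pos_of_nonneg_of_pos (hsq R) one_pos, fun v => ?_⟩
  rw [hRv]
  have h0 : ∀ u : ι → ℝ, 0 ≤ ∑ k, u k ^ 2 := fun u => Finset.sum_nonneg fun _ _ => sq_nonneg _
  have h1 := sum_sq_mulVec_le T (R *ᵥ v)
  rw [mulVec_mulVec, hTR, one_mulVec] at h1
  constructor
  · linarith [h0 (R *ᵥ v)]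
  · linarith [sum_sq_mulVec_le R v, h0 v]

/-- Corollary (the case μ = 0, linear matrix inequalities):
under the linear matrix inequalities FᵢᵀQᵢ + QᵢFᵢ ≤ -2νIₙ, Qᵢ ≤ Iₙ and the boundary
inequality, the switched linear hyperbolic system is globally uniformly exponentially
stable with respect to all switching signals.
A switching signal is encoded by its values `sig : ℝ → I` together with its set `times`
of switching times (its discontinuities), and a classical solution is a continuous
function which is C¹ and satisfies the PDE and boundary conditions of the active mode
on every interval free of switching times. -/
theorem stmt_10
    (n : ℕ) (hn : 1 ≤ n) (I : Type) [Fintype I] [Nonempty I]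
    (m : ℕ) (hm : m ≤ n)
    (S : I → Matrix (Fin n) (Fin n) ℝ) (hS : ∀ i, IsUnit (S i))
    (lam : I → Fin n → ℝ)
    (hlam : ∀ i (k : Fin n), if (k : ℕ) < m then lam i k < 0 else 0 < lam i k)
    (A L F : I → Matrix (Fin n) (Fin n) ℝ)
    (hL : ∀ i, L i = (S i)⁻¹ * Matrix.diagonal (lam i) * S i)
    (hF : ∀ i, F i = S i * A i * (S i)⁻¹)
    (G : I → Matrix (Fin n) (Fin n) ℝ)
    (B0 B1 : I → Matrix (Fin n) (Fin n) ℝ)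
    -- B⁰ᵢ = [[-Gᵢ₋₋, 0],[-Gᵢ₊₋, I]] Sᵢ  and  B¹ᵢ = [[I, -Gᵢ₋₊],[0, -Gᵢ₊₊]] Sᵢ
    (hB0 : ∀ i, B0 i = (Matrix.of fun k l : Fin n =>
        if (l : ℕ) < m then -(G i k l) else if k = l then (1:ℝ) else 0) * S i)
    (hB1 : ∀ i, B1 i = (Matrix.of fun k l : Fin n =>
        if (l : ℕ) < m then (if k = l then (1:ℝ) else 0) else -(G i k l)) * S i)
    (ν : ℝ) (hν : 0 < ν)
    (q : I → Fin n → ℝ) (hq : ∀ i k, 0 < q i k)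
    -- E₀ᵢ = [[I, 0],[Gᵢ₊₋, Gᵢ₊₊]],  E₁ᵢ = [[Gᵢ₋₋, Gᵢ₋₊],[0, I]]
    (E0 E1 : I → Matrix (Fin n) (Fin n) ℝ)
    (hE0 : ∀ i, E0 i = Matrix.of fun k l : Fin n =>
        if (k : ℕ) < m then (if k = l then (1:ℝ) else 0) else G i k l)
    (hE1 : ∀ i, E1 i = Matrix.of fun k l : Fin n =>
        if (k : ℕ) < m then G i k l else if k = l then (1:ℝ) else 0)
    -- FᵢᵀQᵢ + QᵢFᵢ ≤ -2νIₙ and Qᵢ ≤ Iₙ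
    (hlmi1 : ∀ i,
      matLE ((F i)ᵀ * Matrix.diagonal (q i) + Matrix.diagonal (q i) * F i)
            (-(2 * ν) • (1 : Matrix (Fin n) (Fin n) ℝ)))
    (hlmi1' : ∀ i, matLE (Matrix.diagonal (q i)) (1 : Matrix (Fin n) (Fin n) ℝ))
    -- E₀ᵢᵀ Qᵢ Λᵢ E₀ᵢ ≤ E₁ᵢᵀ Qᵢ Λᵢ E₁ᵢ
    (hlmi2 : ∀ i,
      matLE ((E0 i)ᵀ * (Matrix.diagonal (q i) * Matrix.diagonal (lam i)) * E0 i)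
            ((E1 i)ᵀ * (Matrix.diagonal (q i) * Matrix.diagonal (lam i)) * E1 i))
    -- (Sᵢ⁻)ᵀ Qᵢ⁻ Sᵢ⁻ = (Sⱼ⁻)ᵀ Qⱼ⁻ Sⱼ⁻ and (Sᵢ⁺)ᵀ Qᵢ⁺ Sᵢ⁺ = (Sⱼ⁺)ᵀ Qⱼ⁺ Sⱼ⁺
    (heqm : ∀ i j,
      (S i)ᵀ * Matrix.diagonal (fun k : Fin n => if (k : ℕ) < m then q i k else 0) * S i
        = (S j)ᵀ * Matrix.diagonal (fun k : Fin n => if (k : ℕ) < m then q j k else 0) * S j)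
    (heqp : ∀ i j,
      (S i)ᵀ * Matrix.diagonal (fun k : Fin n => if (k : ℕ) < m then 0 else q i k) * S i
        = (S j)ᵀ * Matrix.diagonal (fun k : Fin n => if (k : ℕ) < m then 0 else q j k) * S j) :
    ∃ ν' > (0:ℝ), ∃ C > (0:ℝ),
      ∀ (sig : ℝ → I) (times : Set ℝ),
        -- switching times are positive and locally finite
        (∀ t ∈ times, 0 < t) →
        (∀ T : ℝ, (times ∩ Icc 0 T).Finite) →
        -- `sig` is constant (hence right-continuous) between switching times
        (∀ s t : ℝ, 0 ≤ s → s ≤ t → (∀ u, s < u → u ≤ t → u ∉ times) → sig t = sig s) →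
        -- switching times are genuine discontinuities of `sig`
        (∀ t ∈ times, ∀ ε > (0:ℝ), ∃ s, t - ε < s ∧ s < t ∧ sig s ≠ sig t) →
        ∀ w : ℝ → ℝ → Fin n → ℝ,
          -- `w` is continuous on [0,∞) × [0,1]
          ContinuousOn (fun pt : ℝ × ℝ => w pt.1 pt.2) (Ici (0:ℝ) ×ˢ Icc (0:ℝ) 1) →
          -- on every interval free of switching times, `w` is C¹ and satisfies the PDE
          -- and the boundary conditions of the active mode
          (∀ a b : ℝ, 0 ≤ a → a < b → (∀ u, a < u → u < b → u ∉ times) →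
            ContDiffOn ℝ 1 (fun pt : ℝ × ℝ => w pt.1 pt.2) (Icc a b ×ˢ Icc (0:ℝ) 1) ∧
            (∀ t ∈ Icc a b, ∀ x ∈ Icc (0:ℝ) 1,
              fderivWithin ℝ (fun pt : ℝ × ℝ => w pt.1 pt.2)
                  (Icc a b ×ˢ Icc (0:ℝ) 1) (t, x) (1, 0)
                + (L (sig a)).mulVec
                    (fderivWithin ℝ (fun pt : ℝ × ℝ => w pt.1 pt.2)
                      (Icc a b ×ˢ Icc (0:ℝ) 1) (t, x) (0, 1))
                = (A (sig a)).mulVec (w t x)) ∧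
            (∀ t ∈ Icc a b,
              (B0 (sig a)).mulVec (w t 0) + (B1 (sig a)).mulVec (w t 1) = 0)) →
          ∀ t ≥ (0:ℝ),
            Real.sqrt (∫ x in (0:ℝ)..1, ∑ k, (w t x k) ^ 2)
              ≤ C * Real.exp (-ν' * t) * Real.sqrt (∫ x in (0:ℝ)..1, ∑ k, (w 0 x k) ^ 2) := by
  obtain ⟨i₀⟩ := ‹Nonempty I›
  obtain ⟨c, hc, d, hd, hcd⟩ := exists_energy_equiv (hS i₀) (hq i₀)
  refine ⟨ν, hν, √(c * d), sqrt_pos.2 (mul_pos hc hd), ?_⟩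
  intro sig times _ hfin _ _ w hw hsol t ht
  have hP : ∀ i (v : Fin n → ℝ),
      ∑ k, q i k * (S i *ᵥ v) k ^ 2 = ∑ k, q i₀ k * (S i₀ *ᵥ v) k ^ 2 := by
    intro i v
    have hsplit : ∀ j, ∑ k, q j k * (S j *ᵥ v) k ^ 2
        = v ⬝ᵥ ((S j)ᵀ * diagonal (fun k : Fin n => if (k : ℕ) < m then q j k else 0) * S j) *ᵥ v
        + v ⬝ᵥ ((S j)ᵀ * diagonal (fun k : Fin n => if (k : ℕ) < m then 0 else q j k) * S j)
          *ᵥ v := by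
      intro j
      rw [dotProduct_transpose_diagonal_mulVec, dotProduct_transpose_diagonal_mulVec,
        ← Finset.sum_add_distrib]
      refine Finset.sum_congr rfl fun k _ => ?_
      split_ifs <;> ring
    rw [hsplit, hsplit, heqm i i₀, heqp i i₀]
  have hwt : ∀ t, 0 ≤ t → ContinuousOn (fun x => w t x) (Icc (0 : ℝ) 1) := fun t ht =>
    hw.comp (f := fun x => (t, x)) (by fun_prop) fun x hx => ⟨ht, hx⟩
  have hgap : ∀ a b : ℝ, 0 ≤ a → a < b → (∀ u, a < u → u < b → u ∉ times) →
      exp (2 * ν * b) * ∫ x in (0 : ℝ)..1, ∑ k, q i₀ k * (S i₀ *ᵥ w b x) k ^ 2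
      ≤ exp (2 * ν * a) * ∫ x in (0 : ℝ)..1, ∑ k, q i₀ k * (S i₀ *ᵥ w a x) k ^ 2 := by
    intro a b ha hab hfree
    obtain ⟨hC1, hpde, hbc⟩ := hsol a b ha hab hfree
    set i := sig a
    simp only [← hP i]
    have hdet := (isUnit_iff_isUnit_det (S i)).1 (hS i)
    set Φ : (Fin n → ℝ) →L[ℝ] (Fin n → ℝ) := LinearMap.toContinuousLinearMap (S i).mulVecLin
    have hΦ : ∀ v, Φ v = S i *ᵥ v := fun v => rfl
    refine exp_mul_energy_le hab.le (q i) (lam i) (F i) (fun p => S i *ᵥ w p.1 p.2)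
      (fun p => Φ.comp (fderivWithin ℝ (fun pt : ℝ × ℝ => w pt.1 pt.2)
        (Icc a b ×ˢ Icc (0 : ℝ) 1) p)) ?_ ?_ ?_
      (sum_mul_mulVec_le hν (hlmi1 i) (hlmi1' i)) ?_
    · exact Φ.continuous.comp_continuousOn hC1.continuousOn
    · intro p hp
      have hnhds : Icc a b ×ˢ Icc (0 : ℝ) 1 ∈ nhds p :=
        prod_mem_nhds (Icc_mem_nhds hp.1.1 hp.1.2) (Icc_mem_nhds hp.2.1 hp.2.2)
      have hdiff := hC1.differentiableOn one_ne_zero p (mem_of_mem_nhds hnhds)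
      exact Φ.hasFDerivAt.comp p (hdiff.hasFDerivWithinAt.hasFDerivAt hnhds)
    · intro p hp k
      have h := congrArg (fun v => (S i *ᵥ v) k) (hpde p.1 hp.1 p.2 hp.2)
      have hSL : S i * L i = diagonal (lam i) * S i := by
        rw [hL, Matrix.mul_assoc, ← Matrix.mul_assoc, mul_nonsing_inv _ hdet, Matrix.one_mul]
      have hSA : S i * A i = F i * S i := by
        rw [hF, Matrix.mul_assoc, nonsing_inv_mul _ hdet, Matrix.mul_one]
      simp only [mulVec_add, mulVec_mulVec, hSL, hSA] at h
      rw [← mulVec_mulVec, ← mulVec_mulVec, Pi.add_apply, mulVec_diagonal] at h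
      exact h
    · intro t ht
      have h := hbc t ht
      rw [hB0, hB1, ← mulVec_mulVec, ← mulVec_mulVec] at h
      exact boundary_flux_le (G i) (E0 i) (E1 i) (q i) (lam i) (hE0 i) (hE1 i) (hlmi2 i) h
  have hdecay := le_of_le_on_gaps hfin hgap le_rfl ht
  have hint1 : ∀ t, 0 ≤ t → IntervalIntegrable (fun x => ∑ k, w t x k ^ 2)
      MeasureTheory.volume 0 1 := fun t ht =>
    ContinuousOn.intervalIntegrable (by
      rw [uIcc_of_le zero_le_one]
      have := continuousOn_pi.1 (hwt t ht)
      fun_prop)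
  have hint2 : ∀ t, 0 ≤ t → IntervalIntegrable (fun x => ∑ k, q i₀ k * (S i₀ *ᵥ w t x) k ^ 2)
      MeasureTheory.volume 0 1 := fun t ht =>
    ContinuousOn.intervalIntegrable (by
      rw [uIcc_of_le zero_le_one]
      have := continuousOn_pi.1 (hwt t ht)
      simp only [mulVec, dotProduct]
      fun_prop)
  have h1 := intervalIntegral.integral_mono_on zero_le_one (hint1 t ht)
    ((hint2 t ht).const_mul c) fun x _ => (hcd (w t x)).1
  have h2 := intervalIntegral.integral_mono_on zero_le_one (hint2 0 le_rfl)
    ((hint1 0 le_rfl).const_mul d) fun x _ => (hcd (w 0 x)).2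
  rw [intervalIntegral.integral_const_mul] at h1 h2
  rw [mul_zero, exp_zero, one_mul] at hdecay
  have hexp : exp (-ν * t) ^ 2 * exp (2 * ν * t) = 1 := by
    rw [← exp_nat_mul, ← exp_add, exp_eq_one_iff]
    push_cast
    ring
  have hfinal : ∫ x in (0:ℝ)..1, ∑ k, (w t x k) ^ 2
      ≤ c * d * exp (-ν * t) ^ 2 * ∫ x in (0:ℝ)..1, ∑ k, (w 0 x k) ^ 2 := by
    have h3 := mul_le_mul_of_nonneg_left (hdecay.trans h2)
      (mul_nonneg hc.le (sq_nonneg (exp (-ν * t))))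
    refine h1.trans (le_trans (le_of_eq ?_) (h3.trans (le_of_eq (by ring))))
    linear_combination (-c * ∫ x in (0 : ℝ)..1, ∑ k, q i₀ k * (S i₀ *ᵥ w t x) k ^ 2) * hexp
  refine (sqrt_le_sqrt hfinal).trans (le_of_eq ?_)
  rw [sqrt_mul (by positivity), sqrt_mul (by positivity), sqrt_sq (exp_nonneg _)]
end
end
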